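/- arXiv:2103.09089 — 2 statements merged into one kernel-verified Lean document; each statement's English description precedes it below -/
import Mathlib

section
/- (Berger–Wang) For every bounded subset S ⊂ M_d(ℂ), ρ(S) = limsup_{n→∞} Λ(Sⁿ)^{1/n}. -/
open scoped Pointwise
open Filter

/-- A norm on `ℂ^d`, given as a plain function with the norm axioms. -/
def IsCNorm {d : ℕ} (v : (Fin d → ℂ) → ℝ) : Prop :=
  (∀ x, 0 ≤ v x) ∧ (∀ x, v x = 0 ↔ x = 0) ∧
  (∀ (a : ℂ) (x), v (a • x) = ‖a‖ * v x) ∧ (∀ x y, v (x + y) ≤ v x + v y)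

/-- Operator norm on matrices induced by the norm `v` on `ℂ^d`. -/
noncomputable def opNorm {d : ℕ} (v : (Fin d → ℂ) → ℝ) (A : Matrix (Fin d) (Fin d) ℂ) : ℝ :=
  sSup {c : ℝ | ∃ x : Fin d → ℂ, v x ≤ 1 ∧ c = v (A.mulVec x)}

/-- Norm of a set of matrices: `sup_{s ∈ S} ‖s‖`. -/
noncomputable def setOpNorm {d : ℕ} (v : (Fin d → ℂ) → ℝ)
    (S : Set (Matrix (Fin d) (Fin d) ℂ)) : ℝ :=
  sSup (opNorm v '' S)

/-- The sup norm on `ℂ^d`, used as reference norm to define the joint spectral radius. -/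
noncomputable def stdNorm {d : ℕ} (x : Fin d → ℂ) : ℝ := ‖x‖

/-- The joint spectral radius `ρ(S) = inf_{n ≥ 1} ‖Sⁿ‖^{1/n}`. -/
noncomputable def jsr {d : ℕ} (S : Set (Matrix (Fin d) (Fin d) ℂ)) : ℝ :=
  ⨅ n : ℕ, setOpNorm stdNorm (S ^ (n + 1)) ^ (1 / (n + 1 : ℝ))

/-- The spectral radius of a matrix: the largest modulus of an eigenvalue. -/
noncomputable def specRad {d : ℕ} (A : Matrix (Fin d) (Fin d) ℂ) : ℝ :=
  sSup ((fun μ : ℂ => ‖μ‖) '' spectrum ℂ A)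

/-- `Λ(S) = sup_{s ∈ S} Λ(s)`. -/
noncomputable def lamSet {d : ℕ} (S : Set (Matrix (Fin d) (Fin d) ℂ)) : ℝ :=
  sSup (specRad '' S)

/-- Boundedness of a set of matrices. -/
def MatBdd {d : ℕ} (S : Set (Matrix (Fin d) (Fin d) ℂ)) : Prop :=
  ∃ C : ℝ, ∀ A ∈ S, ∀ i j, ‖A i j‖ ≤ C

/-- `S` is irreducible: it preserves no nonzero proper subspace of `ℂ^d`. -/
def IsIrred {d : ℕ} (S : Set (Matrix (Fin d) (Fin d) ℂ)) : Prop :=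
  ∀ W : Submodule ℂ (Fin d → ℂ), (∀ A ∈ S, ∀ x ∈ W, A.mulVec x ∈ W) → W = ⊥ ∨ W = ⊤

open Polynomial in
theorem bw_nilp {V : Type*} [AddCommGroup V] [Module ℂ V] [FiniteDimensional ℂ V]
    (f : Module.End ℂ V) (h : ∀ k : ℕ, LinearMap.trace ℂ V (f ^ (k + 1)) = 0) : IsNilpotent f := by
  have htr : ∀ g : ℂ[X], LinearMap.trace ℂ V (aeval f (g * X)) = 0 := by
    intro g
    induction g using Polynomial.induction_on' with
    | add p q hp hq => rw [add_mul, map_add, map_add, hp, hq, add_zero]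
    | monomial n a =>
      rw [← C_mul_X_pow_eq_monomial, mul_assoc, ← pow_succ, map_mul, aeval_C, ← Algebra.smul_def,
        map_smul, map_pow, aeval_X, h, smul_zero]
  have hp0 : minpoly ℂ f ≠ 0 := minpoly.ne_zero (Algebra.IsIntegral.isIntegral f)
  obtain ⟨q, hq, hnd⟩ := Polynomial.exists_eq_pow_rootMultiplicity_mul_and_not_dvd _ hp0 0
  set k := rootMultiplicity 0 (minpoly ℂ f)
  rw [map_zero, sub_zero] at hq hnd
  have hco : IsCoprime (X : ℂ[X]) q := (Polynomial.irreducible_X.coprime_iff_not_dvd).2 hnd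
  obtain ⟨a, b, hab⟩ := hco.pow_left (m := k + 1)
  have hpf : aeval f (X ^ k * q) = 0 := by rw [← hq]; exact minpoly.aeval ℂ f
  have he : IsIdempotentElem (aeval f (a * X ^ (k + 1))) := by
    have h1 : (a * X ^ (k+1)) * (a * X ^ (k+1)) = a * X ^ (k+1) - (a * b * X) * (X ^ k * q) := by
      have : b * q = 1 - a * X ^ (k+1) := by rw [← hab]; ring
      calc _ = a * X ^ (k+1) - a * X ^ (k+1) * (1 - a * X ^ (k+1)) := by ring
        _ = _ := by rw [← this]; ring
    rw [IsIdempotentElem, ← map_mul, h1, map_sub, map_mul _ (a * b * X), hpf, mul_zero, sub_zero]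
  have he0 : aeval f (a * X ^ (k + 1)) = 0 := by
    apply LinearMap.IsIdempotentElem.eq_zero_of_trace_eq_zero he
    rw [pow_succ, ← mul_assoc]; exact htr _
  refine ⟨k, ?_⟩
  have h2 : (X : ℂ[X]) ^ k = X ^ k * (a * X ^ (k+1)) + b * (X ^ k * q) := by
    calc (X : ℂ[X]) ^ k = X ^ k * 1 := by ring
      _ = _ := by rw [← hab]; ring
  have := congrArg (aeval f) h2
  rw [map_add, map_mul, he0, map_mul _ b, hpf] at this
  simpa using this

theorem bw_chain {V : Type*} [AddCommGroup V] [Module ℂ V] [FiniteDimensional ℂ V]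
    (W : ℕ → Submodule ℂ V) (hanti : ∀ k, W (k+1) ≤ W k)
    (hst : ∀ k, W (k+1) = W k → W (k+2) = W (k+1)) (hbot : ∃ k, W k = ⊥) :
    W (Module.finrank ℂ V) = ⊥ := by
  obtain ⟨K, hK⟩ := hbot
  have key : ∀ k, W k = ⊥ ∨ Module.finrank ℂ (W k) + k ≤ Module.finrank ℂ V := by
    intro k
    induction k with
    | zero => right; simpa using Submodule.finrank_le _
    | succ k ih =>
      rcases ih with ih | ih
      · left; exact le_bot_iff.1 (ih ▸ hanti k)
      · by_cases he : W (k+1) = W k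
        · left
          have hs : ∀ j, W (k + j + 1) = W (k + j) := by
            intro j
            induction j with
            | zero => exact he
            | succ j ih => exact hst _ ih
          have hs' : ∀ j, W (k + j) = W k := by
            intro j
            induction j with
            | zero => rfl
            | succ j ih => rw [← ih]; exact hs j
          have hA : Antitone W := antitone_nat_of_succ_le hanti
          rw [he, ← hs' K]
          exact le_bot_iff.1 (hK ▸ hA (by omega))
        · right
          have := Submodule.finrank_lt_finrank_of_lt (lt_of_le_of_ne (hanti k) he)
          omega
  rcases key (Module.finrank ℂ V) with h | h
  · exact h
  · exact Submodule.finrank_eq_zero.1 (by omega)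

section bwLie
attribute [local instance] LieRing.ofAssociativeRing

theorem bw_levitzki {V ι : Type*} [AddCommGroup V] [Module ℂ V] [FiniteDimensional ℂ V]
    (A : ι → Module.End ℂ V)
    (h : ∀ l : List ι, l ≠ [] → LinearMap.trace ℂ V (l.map A).prod = 0)
    (l : List ι) (hl : l.length = Module.finrank ℂ V) : (l.map A).prod = 0 := by
  let P : Submodule ℂ (Module.End ℂ V) :=
    Submodule.span ℂ {x | ∃ l : List ι, l ≠ [] ∧ x = (l.map A).prod}
  have hmul : ∀ x ∈ P, ∀ y ∈ P, x * y ∈ P := by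
    intro x hx y hy
    have := Submodule.mul_mem_mul hx hy
    rw [Submodule.span_mul_span] at this
    refine Submodule.span_mono ?_ this
    rintro _ ⟨_, ⟨l, hl, rfl⟩, _, ⟨m, hm, rfl⟩, rfl⟩
    exact ⟨l ++ m, by simp [hl], by simp⟩
  have htr : ∀ x ∈ P, LinearMap.trace ℂ V x = 0 := by
    intro x hx
    have : P ≤ LinearMap.ker (LinearMap.trace ℂ V) := by
      refine Submodule.span_le.2 ?_
      rintro _ ⟨l, hl, rfl⟩
      exact h l hl
    exact this hx
  have hpow : ∀ x ∈ P, ∀ k : ℕ, x ^ (k+1) ∈ P := by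
    intro x hx k
    induction k with
    | zero => simpa using hx
    | succ k ih => rw [pow_succ]; exact hmul _ ih _ hx
  let L : LieSubalgebra ℂ (Module.End ℂ V) :=
    { P with lie_mem' := fun {x y} hx hy => P.sub_mem (hmul x hx y hy) (hmul y hy x hx) }
  have hnil : LieModule.IsNilpotent L V := by
    rw [LieModule.isNilpotent_iff_forall' (R := ℂ)]
    rintro ⟨x, hx⟩
    exact bw_nilp x fun k => htr _ (hpow x hx k)
  have hb := bw_chain (fun k => (LieModule.lowerCentralSeries ℂ L V k).toSubmodule)
    (fun k => LieModule.antitone_lowerCentralSeries ℂ L V (Nat.le_succ k))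
    (fun k hk => by
      have hk' : LieModule.lowerCentralSeries ℂ L V (k+1) = LieModule.lowerCentralSeries ℂ L V k :=
        LieSubmodule.toSubmodule_injective hk
      show (LieModule.lowerCentralSeries ℂ L V (k+1+1)).toSubmodule = _
      rw [LieModule.lowerCentralSeries_succ, hk', ← LieModule.lowerCentralSeries_succ, hk'])
    (by
      obtain ⟨k, hk⟩ := LieModule.IsNilpotent.nilpotent ℂ L V
      exact ⟨k, by simp [hk]⟩)
  have hmem : ∀ (l : List ι) (v : V),
      (l.map A).prod v ∈ LieModule.lowerCentralSeries ℂ L V l.length := by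
    intro l v
    induction l with
    | nil => simp
    | cons i l ih =>
      rw [List.length_cons, LieModule.lowerCentralSeries_succ, List.map_cons, List.prod_cons]
      have hi : A i ∈ L := Submodule.subset_span ⟨[i], by simp, by simp⟩
      exact LieSubmodule.lie_mem_lie (x := (⟨A i, hi⟩ : L)) (LieSubmodule.mem_top _) ih
  ext v
  have := hmem l v
  rw [hl, ← LieSubmodule.mem_toSubmodule] at this
  erw [hb] at this
  simpa using this

end bwLie

theorem bw_levitzki_mat {d : ℕ} {ι : Type*} (A : ι → Matrix (Fin d) (Fin d) ℂ)
    (h : ∀ l : List ι, l ≠ [] → Matrix.trace (l.map A).prod = 0)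
    (l : List ι) (hl : l.length = d) : (l.map A).prod = 0 := by
  have hc : ∀ l : List ι, (l.map fun i => Matrix.toLinAlgEquiv' (A i)).prod
      = Matrix.toLinAlgEquiv' (l.map A).prod := by
    intro l
    rw [map_list_prod, List.map_map]; rfl
  have := bw_levitzki (V := Fin d → ℂ) (fun i => Matrix.toLinAlgEquiv' (A i)) (fun l hl => by
    rw [hc, ← h l hl]
    exact Matrix.trace_toLin'_eq _) l (by simp [hl])
  rw [hc] at this
  simpa using this

open MvPolynomial in
theorem bw_span_bound {σ : Type*} (G : Set (MvPolynomial σ ℂ)) (p : MvPolynomial σ ℂ)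
    (hp : p ∈ Ideal.span G) : ∃ C : ℝ, 0 ≤ C ∧ ∀ x : σ → ℂ, (∀ i, ‖x i‖ ≤ 1) → ∀ δ : ℝ, 0 ≤ δ →
      (∀ g ∈ G, ‖aeval x g‖ ≤ δ) → ‖aeval x p‖ ≤ C * δ := by
  have hb : ∀ f : MvPolynomial σ ℂ, ∃ C : ℝ, 0 ≤ C ∧
      ∀ x : σ → ℂ, (∀ i, ‖x i‖ ≤ 1) → ‖aeval x f‖ ≤ C := by
    intro f
    induction f using MvPolynomial.induction_on with
    | C a => exact ⟨‖a‖, norm_nonneg _, fun x _ => by simp⟩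
    | add p q hp hq =>
      obtain ⟨C, hC, h⟩ := hp
      obtain ⟨D, hD, h'⟩ := hq
      refine ⟨C + D, by positivity, fun x hx => ?_⟩
      rw [map_add]
      exact (norm_add_le _ _).trans (add_le_add (h x hx) (h' x hx))
    | mul_X p i hp =>
      obtain ⟨C, hC, h⟩ := hp
      refine ⟨C, hC, fun x hx => ?_⟩
      rw [map_mul, aeval_X, norm_mul]
      calc _ ≤ C * 1 := mul_le_mul (h x hx) (hx i) (norm_nonneg _) hC
        _ = C := mul_one C
  induction hp using Submodule.span_induction with
  | mem g hg => exact ⟨1, zero_le_one, fun x _ δ _ h => by simpa using h g hg⟩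
  | zero => exact ⟨0, le_rfl, fun x _ δ _ h => by simp⟩
  | add p q _ _ hp hq =>
    obtain ⟨C, hC, h⟩ := hp
    obtain ⟨D, hD, h'⟩ := hq
    refine ⟨C + D, by positivity, fun x hx δ hδ hg => ?_⟩
    rw [map_add, add_mul]
    exact (norm_add_le _ _).trans (add_le_add (h x hx δ hδ hg) (h' x hx δ hδ hg))
  | smul a p _ hp =>
    obtain ⟨C, hC, h⟩ := hp
    obtain ⟨D, hD, h'⟩ := hb a
    refine ⟨D * C, by positivity, fun x hx δ hδ hg => ?_⟩
    rw [smul_eq_mul, map_mul, norm_mul, mul_assoc]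
    exact mul_le_mul (h' x hx) (h x hx δ hδ hg) (norm_nonneg _) hD

open MvPolynomial in
theorem bw_null (d : ℕ) : ∃ (k : ℕ) (C : ℝ), 0 ≤ C ∧ ∀ A : Fin d → Matrix (Fin d) (Fin d) ℂ,
    (∀ i a b, ‖A i a b‖ ≤ 1) → ∀ δ : ℝ, 0 ≤ δ →
    (∀ l : List (Fin d), l ≠ [] → ‖Matrix.trace (l.map A).prod‖ ≤ δ) →
    ∀ a b, ‖(List.ofFn A).prod a b‖ ^ k ≤ C * δ := by
  let Y : Fin d → Matrix (Fin d) (Fin d) (MvPolynomial (Fin d × Fin d × Fin d) ℂ) :=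
    fun i => Matrix.of fun a b => X (i, a, b)
  let M : (Fin d × Fin d × Fin d → ℂ) → Fin d → Matrix (Fin d) (Fin d) ℂ :=
    fun x i => Matrix.of fun a b => x (i, a, b)
  have hY : ∀ x (l : List (Fin d)), (aeval x : MvPolynomial (Fin d × Fin d × Fin d) ℂ →ₐ[ℂ] ℂ).mapMatrix (l.map Y).prod
      = (l.map (M x)).prod := by
    intro x l
    rw [map_list_prod, List.map_map]
    congr 2
    funext i
    ext a b
    simp [Y, M]
  have hent : ∀ x (l : List (Fin d)) a b, aeval x ((l.map Y).prod a b) = (l.map (M x)).prod a b := by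
    intro x l a b
    rw [← hY]; rfl
  have htr : ∀ x (l : List (Fin d)), aeval x (Matrix.trace (l.map Y).prod)
      = Matrix.trace (l.map (M x)).prod := by
    intro x l
    simp only [Matrix.trace, map_sum, Matrix.diag_apply, hent]
  let G : Set (MvPolynomial (Fin d × Fin d × Fin d) ℂ) :=
    {g | ∃ l : List (Fin d), l ≠ [] ∧ g = Matrix.trace (l.map Y).prod}
  have hrad : ∀ a b, ((List.finRange d).map Y).prod a b ∈ (Ideal.span G).radical := by
    intro a b
    rw [← vanishingIdeal_zeroLocus_eq_radical (K := ℂ)]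
    intro x hx
    rw [hent, bw_levitzki_mat (M x) ?_ _ (by simp)]
    · simp
    · intro l hl
      rw [← htr]
      exact hx _ (Ideal.subset_span ⟨l, hl, rfl⟩)
  choose n hn using hrad
  let k := ∑ a, ∑ b, n a b
  have hk : ∀ a b, ((List.finRange d).map Y).prod a b ^ k ∈ Ideal.span G := by
    intro a b
    refine Ideal.pow_mem_of_pow_mem _ (hn a b) ?_
    calc n a b ≤ ∑ b, n a b := Finset.single_le_sum (f := fun b => n a b) (by simp) (Finset.mem_univ b)
      _ ≤ _ := Finset.single_le_sum (f := fun a => ∑ b, n a b) (by simp) (Finset.mem_univ a)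
  choose C hC0 hC using fun a b => bw_span_bound G _ (hk a b)
  refine ⟨k, ∑ a, ∑ b, C a b, Finset.sum_nonneg fun a _ => Finset.sum_nonneg fun b _ => hC0 a b, ?_⟩
  intro A hA δ hδ hl a b
  have hM : M (fun p => A p.1 p.2.1 p.2.2) = A := by
    funext i; ext a b; rfl
  have h1 := hC a b (fun p => A p.1 p.2.1 p.2.2) (fun p => hA _ _ _) δ hδ (by
    rintro _ ⟨l, hl', rfl⟩
    rw [htr, hM]; exact hl l hl')
  rw [map_pow, hent, hM, norm_pow, ← List.ofFn_eq_map] at h1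
  refine h1.trans (mul_le_mul_of_nonneg_right ?_ hδ)
  calc C a b ≤ ∑ b, C a b := Finset.single_le_sum (f := fun b => C a b) (fun b _ => hC0 a b) (Finset.mem_univ b)
      _ ≤ _ := Finset.single_le_sum (f := fun a => ∑ b, C a b) (fun a _ => Finset.sum_nonneg fun b _ => hC0 a b) (Finset.mem_univ a)

/-! ### Norm facts -/

section bwNorm
attribute [local instance] Matrix.linftyOpNormedRing Matrix.linftyOpNormedAlgebra

theorem bw_op_eq {d : ℕ} (A : Matrix (Fin d) (Fin d) ℂ) : opNorm stdNorm A = ‖A‖ := by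
  rw [Matrix.linfty_opNorm_eq_opNorm, ← ContinuousLinearMap.sSup_unitClosedBall_eq_norm]
  unfold opNorm stdNorm
  congr 1
  ext c
  simp only [Set.mem_ofPred_eq, Set.mem_image, Metric.mem_closedBall, dist_zero_right]
  constructor
  · rintro ⟨x, hx, rfl⟩; exact ⟨x, hx, rfl⟩
  · rintro ⟨x, hx, rfl⟩; exact ⟨x, hx, rfl⟩

theorem bw_op_nonneg {d : ℕ} (A : Matrix (Fin d) (Fin d) ℂ) : 0 ≤ opNorm stdNorm A := by
  rw [bw_op_eq]; exact norm_nonneg A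

theorem bw_op_mul {d : ℕ} (A B : Matrix (Fin d) (Fin d) ℂ) :
    opNorm stdNorm (A * B) ≤ opNorm stdNorm A * opNorm stdNorm B := by
  simp only [bw_op_eq]; exact norm_mul_le A B

theorem bw_op_smul {d : ℕ} (c : ℂ) (A : Matrix (Fin d) (Fin d) ℂ) :
    opNorm stdNorm (c • A) = ‖c‖ * opNorm stdNorm A := by
  simp only [bw_op_eq]; exact norm_smul c A

theorem bw_op_one {d : ℕ} : opNorm stdNorm (1 : Matrix (Fin d) (Fin d) ℂ) ≤ 1 := by
  rw [bw_op_eq]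
  rcases Nat.eq_zero_or_pos d with h | h
  · subst h
    rw [Subsingleton.elim (1 : Matrix (Fin 0) (Fin 0) ℂ) 0, norm_zero]; exact zero_le_one
  · have : NeZero d := ⟨h.ne'⟩
    rw [← Matrix.diagonal_one, Matrix.linfty_opNorm_diagonal]
    simp

theorem bw_op_zero_dim (A : Matrix (Fin 0) (Fin 0) ℂ) : opNorm stdNorm A = 0 := by
  rw [bw_op_eq, Subsingleton.elim A 0, norm_zero]

theorem bw_entry {d : ℕ} (A : Matrix (Fin d) (Fin d) ℂ) (i j : Fin d) :
    ‖A i j‖ ≤ opNorm stdNorm A := by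
  rw [bw_op_eq, Matrix.linfty_opNorm_def]
  have h1 : ‖A i j‖₊ ≤ ∑ j, ‖A i j‖₊ :=
    Finset.single_le_sum (f := fun j => ‖A i j‖₊) (by simp) (Finset.mem_univ j)
  have h2 := Finset.le_sup (f := fun i => ∑ j, ‖A i j‖₊) (Finset.mem_univ i)
  exact_mod_cast h1.trans h2

theorem bw_op_le {d : ℕ} (A : Matrix (Fin d) (Fin d) ℂ) (c : ℝ) (hc : 0 ≤ c)
    (h : ∀ i j, ‖A i j‖ ≤ c) : opNorm stdNorm A ≤ d * c := by
  rw [bw_op_eq, Matrix.linfty_opNorm_def]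
  lift c to NNReal using hc
  have : (Finset.univ.sup fun i => ∑ j, ‖A i j‖₊) ≤ d * c := by
    refine Finset.sup_le fun i _ => ?_
    calc ∑ j, ‖A i j‖₊ ≤ ∑ j : Fin d, c := Finset.sum_le_sum fun j _ => h i j
      _ = d * c := by simp
  exact_mod_cast this

theorem bw_spec_le {d : ℕ} (A : Matrix (Fin d) (Fin d) ℂ) (μ : ℂ) (h : μ ∈ spectrum ℂ A) :
    ‖μ‖ ≤ opNorm stdNorm A := by
  have h1 := spectrum.norm_le_norm_mul_of_mem h
  rw [← bw_op_eq, ← bw_op_eq] at h1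
  exact h1.trans (mul_le_of_le_one_right (bw_op_nonneg A) bw_op_one)

end bwNorm

theorem bw_specRad_le {d : ℕ} (A : Matrix (Fin d) (Fin d) ℂ) :
    specRad A ≤ opNorm stdNorm A := by
  refine Real.sSup_le ?_ (bw_op_nonneg A)
  rintro _ ⟨μ, hμ, rfl⟩
  exact bw_spec_le A μ hμ

theorem bw_le_specRad {d : ℕ} (A : Matrix (Fin d) (Fin d) ℂ) (μ : ℂ) (h : μ ∈ spectrum ℂ A) :
    ‖μ‖ ≤ specRad A := by
  refine le_csSup ⟨opNorm stdNorm A, ?_⟩ ⟨μ, h, rfl⟩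
  rintro _ ⟨μ, hμ, rfl⟩
  exact bw_spec_le A μ hμ

theorem bw_specRad_nonneg {d : ℕ} (A : Matrix (Fin d) (Fin d) ℂ) : 0 ≤ specRad A := by
  refine Real.sSup_nonneg ?_
  rintro _ ⟨μ, hμ, rfl⟩
  exact norm_nonneg _

theorem bw_trace_le {d : ℕ} (A : Matrix (Fin d) (Fin d) ℂ) :
    ‖Matrix.trace A‖ ≤ d * specRad A := by
  rw [Matrix.trace_eq_sum_roots_charpoly]
  have h1 : ‖A.charpoly.roots.sum‖ ≤ (A.charpoly.roots.map fun x => ‖x‖).sum :=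
    norm_multiset_sum_le _
  have h2 := Multiset.sum_le_card_nsmul (A.charpoly.roots.map fun x => ‖x‖) (specRad A) (by
    intro y hy
    obtain ⟨μ, hμ, rfl⟩ := Multiset.mem_map.1 hy
    apply bw_le_specRad
    rw [Matrix.mem_spectrum_iff_isRoot_charpoly]
    exact Polynomial.isRoot_of_mem_roots hμ)
  have h3 : A.charpoly.roots.card ≤ d := by
    have := Polynomial.card_roots' A.charpoly
    rwa [Matrix.charpoly_natDegree_eq_dim, Fintype.card_fin] at this
  rw [Multiset.card_map, nsmul_eq_mul] at h2
  refine h1.trans (h2.trans (mul_le_mul_of_nonneg_right ?_ (bw_specRad_nonneg A)))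
  exact_mod_cast h3

theorem bw_null' (d : ℕ) (hd : 0 < d) : ∃ (k : ℕ) (C : ℝ), 0 ≤ C ∧
    ∀ A : Fin d → Matrix (Fin d) (Fin d) ℂ,
    (∀ i, opNorm stdNorm (A i) ≤ 1) → ∀ δ : ℝ, 0 ≤ δ →
    (∀ l : List (Fin d), l ≠ [] → specRad (l.map A).prod ≤ δ) →
    opNorm stdNorm (List.ofFn A).prod ^ k ≤ C * δ := by
  obtain ⟨k, C, hC, h⟩ := bw_null d
  refine ⟨k, d ^ k * (C * d), by positivity, fun A hA δ hδ hl => ?_⟩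
  have h1 := h A (fun i a b => (bw_entry _ a b).trans (hA i)) (d * δ) (by positivity)
    (fun l hl' => (bw_trace_le _).trans (mul_le_mul_of_nonneg_left (hl l hl') (by positivity)))
  have : Nonempty (Fin d × Fin d) := ⟨(⟨0, hd⟩, ⟨0, hd⟩)⟩
  set P := (List.ofFn A).prod
  obtain ⟨p, hp⟩ := Finite.exists_max fun p : Fin d × Fin d => ‖P p.1 p.2‖
  have h2 := bw_op_le P ‖P p.1 p.2‖ (norm_nonneg _) fun i j => hp (i, j)
  calc opNorm stdNorm P ^ k ≤ (d * ‖P p.1 p.2‖) ^ k := pow_le_pow_left₀ (bw_op_nonneg P) h2 k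
    _ = d ^ k * ‖P p.1 p.2‖ ^ k := mul_pow _ _ _
    _ ≤ d ^ k * (C * (d * δ)) := mul_le_mul_of_nonneg_left (h1 _ _) (by positivity)
    _ = _ := by ring

/-! ### Sets of products -/

theorem bw_pow_bound {d : ℕ} (T : Set (Matrix (Fin d) (Fin d) ℂ)) (K : ℝ) (hK : 0 ≤ K)
    (h : ∀ A ∈ T, opNorm stdNorm A ≤ K) (n : ℕ) :
    ∀ A ∈ T ^ n, opNorm stdNorm A ≤ K ^ n := by
  induction n with
  | zero =>
    intro A hA
    rw [pow_zero, Set.mem_one] at hA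
    rw [hA, pow_zero]
    exact bw_op_one
  | succ n ih =>
    intro A hA
    rw [pow_succ] at hA
    obtain ⟨B, hB, D, hD, rfl⟩ := Set.mem_mul.1 hA
    rw [pow_succ]
    exact (bw_op_mul B D).trans
      (mul_le_mul (ih B hB) (h D hD) (bw_op_nonneg D) (by positivity))

theorem bw_bdd {d : ℕ} (S : Set (Matrix (Fin d) (Fin d) ℂ)) (hS : MatBdd S) (n : ℕ) :
    BddAbove (opNorm stdNorm '' (S ^ n)) := by
  obtain ⟨C, hC⟩ := hS
  refine ⟨(d * |C|) ^ n, ?_⟩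
  rintro _ ⟨A, hA, rfl⟩
  exact bw_pow_bound S (d * |C|) (by positivity)
    (fun A hA => bw_op_le A |C| (abs_nonneg C) fun i j => (hC A hA i j).trans (le_abs_self C))
    n A hA

theorem bw_le_N {d : ℕ} (S : Set (Matrix (Fin d) (Fin d) ℂ)) (hS : MatBdd S) (n : ℕ)
    (A : Matrix (Fin d) (Fin d) ℂ) (hA : A ∈ S ^ n) :
    opNorm stdNorm A ≤ setOpNorm stdNorm (S ^ n) :=
  le_csSup (bw_bdd S hS n) ⟨A, hA, rfl⟩

theorem bw_N_nonneg {d : ℕ} (T : Set (Matrix (Fin d) (Fin d) ℂ)) : 0 ≤ setOpNorm stdNorm T := by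
  refine Real.sSup_nonneg ?_
  rintro _ ⟨A, _, rfl⟩
  exact bw_op_nonneg A

theorem bw_lam_nonneg {d : ℕ} (T : Set (Matrix (Fin d) (Fin d) ℂ)) : 0 ≤ lamSet T := by
  refine Real.sSup_nonneg ?_
  rintro _ ⟨A, _, rfl⟩
  exact bw_specRad_nonneg A

theorem bw_le_lam {d : ℕ} (S : Set (Matrix (Fin d) (Fin d) ℂ)) (hS : MatBdd S) (n : ℕ)
    (A : Matrix (Fin d) (Fin d) ℂ) (hA : A ∈ S ^ n) :
    specRad A ≤ lamSet (S ^ n) := by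
  refine le_csSup ⟨setOpNorm stdNorm (S ^ n), ?_⟩ ⟨A, hA, rfl⟩
  rintro _ ⟨B, hB, rfl⟩
  exact (bw_specRad_le B).trans (bw_le_N S hS n B hB)

theorem bw_N_pow {d : ℕ} (S : Set (Matrix (Fin d) (Fin d) ℂ)) (hS : MatBdd S) (m q : ℕ) :
    ∀ A ∈ S ^ (m * q), opNorm stdNorm A ≤ setOpNorm stdNorm (S ^ m) ^ q := by
  rw [pow_mul]
  exact bw_pow_bound _ _ (bw_N_nonneg _) (bw_le_N S hS m) q

theorem bw_root_le {x c : ℝ} (hx : 0 ≤ x) (hc : 0 ≤ c) (n : ℕ) (h : x ≤ c ^ (n + 1)) :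
    x ^ (1 / (n + 1 : ℝ)) ≤ c := by
  have := Real.rpow_le_rpow hx h (z := 1 / (n + 1 : ℝ)) (by positivity)
  refine this.trans (le_of_eq ?_)
  have h2 := Real.pow_rpow_inv_natCast hc (Nat.succ_ne_zero n)
  rw [one_div]
  simpa using h2

theorem bw_root_pow {x : ℝ} (hx : 0 ≤ x) (n : ℕ) : (x ^ (1 / (n + 1 : ℝ))) ^ (n + 1) = x := by
  have h2 := Real.rpow_inv_natCast_pow hx (Nat.succ_ne_zero n)
  rw [one_div]
  simpa using h2

theorem bw_easy {d : ℕ} (S : Set (Matrix (Fin d) (Fin d) ℂ)) (hS : MatBdd S) (n : ℕ) :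
    lamSet (S ^ (n + 1)) ^ (1 / (n + 1 : ℝ)) ≤ jsr S := by
  refine le_ciInf fun m => ?_
  set N := setOpNorm stdNorm (S ^ (m + 1)) with hN
  have hN0 : 0 ≤ N := bw_N_nonneg _
  set c := N ^ (1 / (m + 1 : ℝ)) with hc
  have hc0 : 0 ≤ c := Real.rpow_nonneg hN0 _
  have hcN : c ^ (m + 1) = N := bw_root_pow hN0 m
  refine bw_root_le (bw_lam_nonneg _) hc0 n ?_
  refine Real.sSup_le ?_ (by positivity)
  rintro _ ⟨A, hA, rfl⟩
  refine Real.sSup_le ?_ (by positivity)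
  rintro _ ⟨μ, hμ, rfl⟩
  have h1 : μ ^ (m + 1) ∈ spectrum ℂ (A ^ (m + 1)) := spectrum.pow_mem_pow A (m + 1) hμ
  have h2 := bw_spec_le _ _ h1
  have h3 : A ^ (m + 1) ∈ S ^ ((m + 1) * (n + 1)) := by
    rw [mul_comm, pow_mul]; exact Set.pow_mem_pow hA
  have h4 := h2.trans (bw_N_pow S hS (m + 1) (n + 1) _ h3)
  rw [norm_pow, ← hN, ← hcN, ← pow_mul, mul_comm (m + 1), pow_mul] at h4
  exact le_of_pow_le_pow_left₀ (Nat.succ_ne_zero m) (by positivity) h4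

theorem bw_jsr_nonneg {d : ℕ} (S : Set (Matrix (Fin d) (Fin d) ℂ)) : 0 ≤ jsr S :=
  Real.iInf_nonneg fun _ => Real.rpow_nonneg (bw_N_nonneg _) _

theorem bw_jsr_le {d : ℕ} (S : Set (Matrix (Fin d) (Fin d) ℂ)) (n : ℕ) (hn : 0 < n) :
    jsr S ^ n ≤ setOpNorm stdNorm (S ^ n) := by
  obtain ⟨m, rfl⟩ := Nat.exists_eq_succ_of_ne_zero hn.ne'
  have h1 : jsr S ≤ setOpNorm stdNorm (S ^ (m + 1)) ^ (1 / (m + 1 : ℝ)) := by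
    refine ciInf_le (f := fun n : ℕ => setOpNorm stdNorm (S ^ (n + 1)) ^ (1 / (n + 1 : ℝ)))
      ⟨0, ?_⟩ m
    rintro _ ⟨k, rfl⟩
    exact Real.rpow_nonneg (bw_N_nonneg _) _
  have h2 := pow_le_pow_left₀ (bw_jsr_nonneg S) h1 (m + 1)
  rwa [bw_root_pow (bw_N_nonneg _)] at h2

theorem bw_map_smul_prod {d : ℕ} {ι : Type*} (c : ℂ) (B : ι → Matrix (Fin d) (Fin d) ℂ)
    (l : List ι) : (l.map fun i => c • B i).prod = c ^ l.length • (l.map B).prod := by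
  induction l with
  | nil => simp
  | cons i l ih =>
    rw [List.map_cons, List.prod_cons, ih, List.map_cons, List.prod_cons, List.length_cons,
      smul_mul_smul_comm, pow_succ']

theorem bw_map_mem {d : ℕ} {ι : Type*} (T : Set (Matrix (Fin d) (Fin d) ℂ))
    (B : ι → Matrix (Fin d) (Fin d) ℂ) (hB : ∀ i, B i ∈ T)
    (l : List ι) : (l.map B).prod ∈ T ^ l.length := by
  induction l with
  | nil => simp
  | cons i l ih =>
    rw [List.map_cons, List.prod_cons, List.length_cons, pow_succ']
    exact Set.mul_mem_mul (hB i) ih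

theorem bw_specRad_smul {d : ℕ} (c : ℂ) (hc : c ≠ 0) (A : Matrix (Fin d) (Fin d) ℂ) :
    specRad (c • A) ≤ ‖c‖ * specRad A := by
  refine Real.sSup_le ?_ (mul_nonneg (norm_nonneg _) (bw_specRad_nonneg A))
  rintro _ ⟨μ, hμ, rfl⟩
  have h1 : c⁻¹ * μ ∈ spectrum ℂ A := by
    have h2 := spectrum.unit_smul_eq_smul A (Units.mk0 c hc)
    have h3 : Units.mk0 c hc • A = c • A := rfl
    rw [← h3, h2] at hμ
    obtain ⟨ν, hν, rfl⟩ := hμ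
    have : c⁻¹ * (c * ν) = ν := by field_simp
    exact (this.symm ▸ hν : c⁻¹ * (c * ν) ∈ spectrum ℂ A)
  have h2 := bw_le_specRad A _ h1
  have h3 : ‖μ‖ = ‖c‖ * ‖c⁻¹ * μ‖ := by
    rw [← norm_mul]; congr 1; field_simp
  show ‖μ‖ ≤ _
  rw [h3]
  exact mul_le_mul_of_nonneg_left h2 (norm_nonneg _)

theorem bw_hard {d : ℕ} (S : Set (Matrix (Fin d) (Fin d) ℂ)) (hS : MatBdd S) (r : ℝ) (hr : 0 < r)
    (hrρ : r < jsr S) (K : ℕ) (hK : ∀ n, K ≤ n → lamSet (S ^ n) ≤ r ^ n) : False := by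
  set ρ := jsr S with hρ
  have hρ0 : 0 < ρ := hr.trans hrρ
  have hd : 0 < d := by
    rcases Nat.eq_zero_or_pos d with h | h
    · subst h
      exfalso
      have h1 := bw_jsr_le S 1 one_pos
      have h2 : setOpNorm stdNorm (S ^ 1) ≤ 0 := by
        refine Real.sSup_le ?_ le_rfl
        rintro _ ⟨A, _, rfl⟩
        exact (bw_op_zero_dim A).le
      rw [pow_one] at h1
      linarith
    · exact h
  obtain ⟨k, C, hC, hnull⟩ := bw_null' d hd
  have hq1 : r / ρ < 1 := (div_lt_one hρ0).2 hrρ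
  have hq0 : 0 < r / ρ := by positivity
  -- key estimate
  have key : ∀ n, K ≤ n → 0 < n → ∀ P ∈ S ^ (n * d),
      opNorm stdNorm P ^ k ≤ C * (r / ρ) ^ n * (setOpNorm stdNorm (S ^ n) ^ d) ^ k := by
    intro n hKn hn P hP
    rw [pow_mul, Set.mem_pow] at hP
    obtain ⟨f, hf⟩ := hP
    set a := setOpNorm stdNorm (S ^ n) with ha
    have haρ : ρ ^ n ≤ a := bw_jsr_le S n hn
    have ha0 : 0 < a := lt_of_lt_of_le (by positivity) haρ
    have hac : (a : ℂ) ≠ 0 := by exact_mod_cast ha0.ne'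
    let B : Fin d → Matrix (Fin d) (Fin d) ℂ := fun i => f i
    let A : Fin d → Matrix (Fin d) (Fin d) ℂ := fun i => (a : ℂ)⁻¹ • B i
    have hna : ‖(a : ℂ)⁻¹‖ = a⁻¹ := by
      rw [norm_inv, Complex.norm_real, Real.norm_of_nonneg ha0.le]
    have hA1 : ∀ i, opNorm stdNorm (A i) ≤ 1 := by
      intro i
      rw [bw_op_smul, hna]
      have := bw_le_N S hS n (B i) (f i).2
      rw [inv_mul_le_iff₀ ha0, mul_one]
      exact this
    have h1 := hnull A hA1 ((r / ρ) ^ n) (by positivity) (by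
      intro l hl
      rw [bw_map_smul_prod]
      refine (bw_specRad_smul _ (pow_ne_zero _ (inv_ne_zero hac)) _).trans ?_
      have hl1 : 1 ≤ l.length := List.length_pos_of_ne_nil hl
      have hm : (l.map B).prod ∈ S ^ (n * l.length) := by
        rw [pow_mul]; exact bw_map_mem _ B (fun i => (f i).2) l
      have h2 := (bw_le_lam S hS _ _ hm).trans
        (hK (n * l.length) (hKn.trans (Nat.le_mul_of_pos_right n hl1)))
      rw [norm_pow, hna]
      have h3 : a⁻¹ ≤ (ρ ^ n)⁻¹ := inv_anti₀ (by positivity) haρ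
      calc a⁻¹ ^ l.length * specRad (l.map B).prod
          ≤ ((ρ ^ n)⁻¹) ^ l.length * r ^ (n * l.length) :=
            mul_le_mul (pow_le_pow_left₀ (by positivity) h3 _) h2 (bw_specRad_nonneg _)
              (by positivity)
        _ = ((r / ρ) ^ n) ^ l.length := by
            rw [pow_mul, ← mul_pow, div_pow]; congr 1; field_simp
        _ ≤ ((r / ρ) ^ n) ^ 1 :=
            pow_le_pow_of_le_one (by positivity) (pow_le_one₀ hq0.le hq1.le) hl1
        _ = _ := pow_one _)
    have h4 : (List.ofFn A).prod = (a : ℂ)⁻¹ ^ d • P := by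
      rw [← hf, List.ofFn_eq_map, List.ofFn_eq_map, bw_map_smul_prod, List.length_finRange]
    rw [h4, bw_op_smul, norm_pow, hna, mul_pow] at h1
    have h5 : (a⁻¹ ^ d) ^ k * (a ^ d) ^ k = 1 := by
      rw [← mul_pow, ← mul_pow, inv_mul_cancel₀ ha0.ne', one_pow, one_pow]
    calc opNorm stdNorm P ^ k = ((a⁻¹ ^ d) ^ k * opNorm stdNorm P ^ k) * (a ^ d) ^ k := by
          rw [mul_right_comm, h5, one_mul]
      _ ≤ _ := mul_le_mul_of_nonneg_right h1 (by positivity)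
  -- choice of `t`
  obtain ⟨t, ht1, htρ⟩ : ∃ t, r / ρ * ((t / ρ) ^ d) ^ k < 1 ∧ ρ < t := by
    have hcont : Continuous fun t : ℝ => r / ρ * ((t / ρ) ^ d) ^ k := by fun_prop
    have h1 : r / ρ * ((ρ / ρ) ^ d) ^ k < 1 := by
      rw [div_self hρ0.ne', one_pow, one_pow, mul_one]; exact hq1
    have h2 := (hcont.tendsto ρ).eventually_lt_const h1
    exact ((h2.filter_mono nhdsWithin_le_nhds).and
      (self_mem_nhdsWithin : Set.Ioi ρ ∈ nhdsWithin ρ (Set.Ioi ρ))).exists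
  have ht0 : 0 < t := hρ0.trans htρ
  obtain ⟨m, hm⟩ := exists_lt_of_ciInf_lt
    (f := fun n : ℕ => setOpNorm stdNorm (S ^ (n + 1)) ^ (1 / (n + 1 : ℝ))) htρ
  have hm' : setOpNorm stdNorm (S ^ (m + 1)) ≤ t ^ (m + 1) := by
    have := pow_le_pow_left₀ (Real.rpow_nonneg (bw_N_nonneg _) _) hm.le (m + 1)
    rwa [bw_root_pow (bw_N_nonneg _)] at this
  set y := r / ρ * ((t / ρ) ^ d) ^ k with hy
  have hy0 : 0 ≤ y := by positivity
  have hlim : Tendsto (fun n : ℕ => 2 ^ k * C * y ^ n) atTop (nhds 0) := by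
    simpa using (tendsto_pow_atTop_nhds_zero_of_lt_one hy0 ht1).const_mul (2 ^ k * C)
  obtain ⟨n0, hn0⟩ := eventually_atTop.1 (hlim.eventually_lt_const one_pos)
  let q := max n0 (max K 1)
  let n := (m + 1) * q
  have hnq : q ≤ n := Nat.le_mul_of_pos_left q (Nat.succ_pos m)
  have hnn0 : n0 ≤ n := (le_max_left _ _).trans hnq
  have hnK : K ≤ n := ((le_max_left _ _).trans (le_max_right _ _)).trans hnq
  have hn1 : 0 < n := ((le_max_right _ _).trans (le_max_right _ _)).trans hnq
  have han : setOpNorm stdNorm (S ^ n) ≤ t ^ n := by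
    refine Real.sSup_le ?_ (by positivity)
    rintro _ ⟨A, hA, rfl⟩
    refine (bw_N_pow S hS (m + 1) q A hA).trans ?_
    show _ ≤ t ^ ((m + 1) * q)
    rw [pow_mul]
    exact pow_le_pow_left₀ (bw_N_nonneg _) hm' q
  have hlow := bw_jsr_le S (n * d) (Nat.mul_pos hn1 hd)
  rw [← hρ] at hlow
  have hpos : 0 < ρ ^ (n * d) := by positivity
  have hne : (opNorm stdNorm '' (S ^ (n * d))).Nonempty := by
    by_contra hemp
    rw [Set.not_nonempty_iff_eq_empty] at hemp
    rw [setOpNorm, hemp, Real.sSup_empty] at hlow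
    linarith
  obtain ⟨_, ⟨P, hP, rfl⟩, hPlt⟩ := exists_lt_of_lt_csSup hne
    (lt_of_lt_of_le (half_lt_self hpos) hlow)
  have h1 := key n hnK hn1 P hP
  have h2 : (ρ ^ (n * d) / 2) ^ k ≤ C * (r / ρ) ^ n * ((t ^ n) ^ d) ^ k := by
    refine (pow_le_pow_left₀ (by positivity) hPlt.le k).trans (h1.trans ?_)
    refine mul_le_mul_of_nonneg_left ?_ (by positivity)
    exact pow_le_pow_left₀ (pow_nonneg (bw_N_nonneg _) _)
      (pow_le_pow_left₀ (bw_N_nonneg _) han d) k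
  have h3 := hn0 n hnn0
  have h4 : 2 ^ k * C * y ^ n * (ρ ^ (n * d) / 2) ^ k
      = C * (r / ρ) ^ n * ((t ^ n) ^ d) ^ k := by
    have e1 : ((t / ρ) ^ d) ^ k * (ρ ^ d) ^ k = (t ^ d) ^ k := by
      rw [← mul_pow, ← mul_pow, div_mul_cancel₀ _ hρ0.ne']
    have e2 : (ρ ^ (n * d) / 2) ^ k * 2 ^ k = ((ρ ^ d) ^ k) ^ n := by
      rw [← mul_pow, div_mul_cancel₀ _ (two_ne_zero), ← pow_mul, ← pow_mul, ← pow_mul]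
      congr 1; ring
    have e3 : ((t ^ n) ^ d) ^ k = ((t ^ d) ^ k) ^ n := by
      simp only [← pow_mul]; congr 1; ring
    calc _ = C * y ^ n * ((ρ ^ (n * d) / 2) ^ k * 2 ^ k) := by ring
      _ = C * (y * (ρ ^ d) ^ k) ^ n := by rw [e2, mul_pow y ((ρ ^ d) ^ k) n, mul_assoc]
      _ = C * (r / ρ * (t ^ d) ^ k) ^ n := by rw [hy, mul_assoc, e1]
      _ = _ := by rw [e3, mul_pow, mul_assoc]
  rw [← h4] at h2
  have h5 : 0 < (ρ ^ (n * d) / 2) ^ k := by positivity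
  nlinarith

/-- Berger–Wang: for every bounded `S ⊂ M_d(ℂ)`,
`ρ(S) = limsup_{n→∞} Λ(Sⁿ)^{1/n}`. -/
theorem stmt_10 {d : ℕ} (S : Set (Matrix (Fin d) (Fin d) ℂ)) (hS : MatBdd S) :
    jsr S = Filter.limsup (fun n : ℕ => lamSet (S ^ (n + 1)) ^ (1 / (n + 1 : ℝ))) atTop := by
  have h0 : ∀ n : ℕ, 0 ≤ lamSet (S ^ (n + 1)) ^ (1 / (n + 1 : ℝ)) :=
    fun n => Real.rpow_nonneg (bw_lam_nonneg _) _
  have hb : IsBoundedUnder (· ≤ ·) atTop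
      (fun n : ℕ => lamSet (S ^ (n + 1)) ^ (1 / (n + 1 : ℝ))) :=
    isBoundedUnder_of ⟨jsr S, bw_easy S hS⟩
  have hb' : IsCoboundedUnder (· ≤ ·) atTop
      (fun n : ℕ => lamSet (S ^ (n + 1)) ^ (1 / (n + 1 : ℝ))) :=
    (isBoundedUnder_of ⟨0, h0⟩ : IsBoundedUnder (· ≥ ·) atTop _).isCoboundedUnder_le
  apply le_antisymm
  · by_contra hlt
    rw [not_le] at hlt
    obtain ⟨r, hr1, hr2⟩ := exists_between hlt
    have hev := eventually_lt_of_limsup_lt hr1 hb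
    obtain ⟨K, hK⟩ := eventually_atTop.1 hev
    have hr : 0 < r := (h0 K).trans_lt (hK K le_rfl)
    refine bw_hard S hS r hr hr2 (K + 1) fun n hn => ?_
    obtain ⟨m, rfl⟩ : ∃ m, n = m + 1 := ⟨n - 1, by omega⟩
    have h1 := pow_le_pow_left₀ (h0 m) (hK m (by omega)).le (m + 1)
    rwa [bw_root_pow (bw_lam_nonneg _)] at h1
  · exact limsup_le_of_le hb' (Eventually.of_forall (bw_easy S hS))
end

section
/- Let S ⊂ M_d(ℂ) be bounded with ρ(S) = 1. Set n₀(d) = 3^d·4^{d²} and let ε > 0. If n ≥ ε^{−d²}·n₀(d), then max_{k ≤ n} Λ(S^k) ≥ 1 − ε. -/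
open scoped Pointwise
open Filter

open MeasureTheory in
/-- Volume packing bound for separated points in the unit ball of a norm on `ℂ^d`. -/
lemma packing {d : ℕ} (p : Seminorm ℂ (Fin d → ℂ)) (C : ℝ) (hlow : ∀ x, ‖x‖ ≤ p x)
    (hup : ∀ x, p x ≤ C * ‖x‖) {ι : Type} [Fintype ι] (pts : ι → Fin d → ℂ)
    (hpts : ∀ i, p (pts i) ≤ 1) (δ : ℝ) (hδ : 0 < δ)
    (hsep : ∀ i j, i ≠ j → δ ≤ p (pts i - pts j)) :
    (Fintype.card ι : ℝ) * (δ / 2) ^ (2 * d) ≤ (1 + δ / 2) ^ (2 * d) := by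
  classical
  let μ : Measure (Fin d → ℂ) := volume
  have hC : 0 ≤ max C 0 := le_max_right _ _
  have hcont : Continuous p := by
    apply Seminorm.continuous_of_continuousAt_zero
    rw [ContinuousAt, map_zero]
    refine squeeze_zero (fun x => apply_nonneg p x) hup ?_
    have : Continuous fun x : Fin d → ℂ => C * ‖x‖ := by fun_prop
    simpa using this.tendsto 0
  have hopen : ∀ x r, IsOpen (p.ball x r) := by
    intro x r
    have : p.ball x r = (fun y => p (y - x)) ⁻¹' Set.Iio r := by
      ext y; simp [Seminorm.mem_ball]
    rw [this]
    exact isOpen_Iio.preimage (hcont.comp (continuous_id.sub continuous_const))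
  have hfin : Module.finrank ℝ (Fin d → ℂ) = 2 * d := by
    rw [Module.finrank_pi_fintype]
    simp [mul_comm]
  have hvol : ∀ x r, 0 < r → μ (p.ball x r) = ENNReal.ofReal (r ^ (2 * d)) * μ (p.ball 0 1) := by
    intro x r hr
    have h1 : p.ball x r = x +ᵥ (r • p.ball 0 1) := by
      have h2 : r • p.ball (0 : Fin d → ℂ) 1 = (r : ℂ) • p.ball 0 1 := by
        ext y
        simp only [Set.mem_smul_set]
        rfl
      have hr' : (r : ℂ) ≠ 0 := by exact_mod_cast hr.ne'
      rw [h2, Seminorm.smul_ball_zero hr', Seminorm.vadd_ball]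
      simp [abs_of_pos hr]
    rw [h1, measure_vadd, Measure.addHaar_smul, hfin, abs_of_pos (by positivity)]
  have hpos : μ (p.ball 0 1) ≠ 0 := by
    apply ((hopen 0 1).measure_pos μ ⟨0, by simp [Seminorm.mem_ball]⟩).ne'
  have hlt : μ (p.ball 0 1) ≠ ⊤ := by
    have : p.ball 0 1 ⊆ Metric.ball (0 : Fin d → ℂ) 1 := by
      intro y hy
      rw [Seminorm.mem_ball, sub_zero] at hy
      rw [mem_ball_zero_iff]
      exact (hlow y).trans_lt hy
    exact ((measure_mono this).trans_lt measure_ball_lt_top).ne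
  have hdis : Pairwise (Function.onFun Disjoint fun i => p.ball (pts i) (δ / 2)) := by
    intro i j hij
    rw [Function.onFun, Set.disjoint_left]
    intro y hy hy'
    rw [Seminorm.mem_ball] at hy hy'
    have h1 := hsep i j hij
    have h2 : p (pts i - pts j) ≤ p (y - pts j) + p (y - pts i) := by
      have := map_sub_le_add p (y - pts j) (y - pts i)
      simpa using this
    linarith
  have hsub : (⋃ i, p.ball (pts i) (δ / 2)) ⊆ p.ball 0 (1 + δ / 2) := by
    intro y hy
    rw [Set.mem_iUnion] at hy
    obtain ⟨i, hi⟩ := hy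
    rw [Seminorm.mem_ball] at hi ⊢
    have h2 : p y ≤ p (y - pts i) + p (pts i) := by
      simpa using map_add_le_add p (y - pts i) (pts i)
    rw [sub_zero]
    linarith [hpts i]
  have I : ((Fintype.card ι : ENNReal) * ENNReal.ofReal ((δ / 2) ^ (2 * d))) * μ (p.ball 0 1)
      ≤ ENNReal.ofReal ((1 + δ / 2) ^ (2 * d)) * μ (p.ball 0 1) := by
    rw [← hvol 0 _ (by positivity)]
    refine le_trans (le_of_eq ?_) (measure_mono hsub)
    rw [measure_iUnion hdis (fun i => (hopen _ _).measurableSet), tsum_fintype]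
    simp only [hvol _ _ (half_pos hδ), Finset.sum_const, nsmul_eq_mul, mul_assoc,
      Finset.card_univ]
  have J := (ENNReal.mul_le_mul_iff_left hpos hlt).1 I
  have K := ENNReal.toReal_le_of_le_ofReal (by positivity) J
  rw [ENNReal.toReal_mul, ENNReal.toReal_ofReal (by positivity)] at K
  simpa using K

/-- Roots of unity are separated. -/
lemma roots_sep (M : ℕ) (a b : Fin M) (hab : a ≠ b) :
    4 / (M : ℝ) ≤ ‖Complex.exp (Complex.I * ((2 * Real.pi * a / M : ℝ) : ℂ))
      - Complex.exp (Complex.I * ((2 * Real.pi * b / M : ℝ) : ℂ))‖ := by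
  wlog h : b < a generalizing a b
  · rw [norm_sub_rev]
    exact this b a hab.symm (lt_of_le_of_ne (not_lt.1 h) hab)
  have hM : (0 : ℝ) < M := by exact_mod_cast (Nat.zero_le _).trans_lt a.2
  have hnorm : ∀ t : ℝ, ‖Complex.exp (Complex.I * (t : ℂ))‖ = 1 := by
    intro t; rw [mul_comm]; exact Complex.norm_exp_ofReal_mul_I t
  set t : ℝ := Real.pi * ((a : ℝ) - b) / M with ht
  have hfac : Complex.exp (Complex.I * ((2 * Real.pi * a / M : ℝ) : ℂ))
      - Complex.exp (Complex.I * ((2 * Real.pi * b / M : ℝ) : ℂ)) =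
      Complex.exp (Complex.I * ((2 * Real.pi * b / M : ℝ) : ℂ)) *
        (Complex.exp (Complex.I * ((2 * t : ℝ) : ℂ)) - 1) := by
    rw [mul_sub, ← Complex.exp_add, mul_one]
    congr 2
    rw [← mul_add, ← Complex.ofReal_add]
    congr 2
    rw [ht]; field_simp; ring
  rw [hfac, norm_mul, hnorm, one_mul, Complex.norm_exp_I_mul_ofReal_sub_one]
  have e : 2 * t / 2 = t := by ring
  rw [e, Real.norm_eq_abs]
  refine le_trans ?_ (le_abs_self _)
  have h1 : (1 : ℝ) ≤ (a : ℝ) - b := by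
    have : (b : ℕ) + 1 ≤ a := h
    have : ((b : ℕ) : ℝ) + 1 ≤ (a : ℕ) := by exact_mod_cast this
    linarith
  have h2 : (a : ℝ) - b ≤ M - 1 := by
    have h3 : (a : ℕ) + 1 ≤ M := a.2
    have h3 : ((a : ℕ) : ℝ) + 1 ≤ M := by exact_mod_cast h3
    have h4 : (0 : ℝ) ≤ (b : ℕ) := Nat.cast_nonneg _
    linarith
  have hpi := Real.pi_pos
  have t1 : Real.pi / M ≤ t := by
    rw [ht]; gcongr; nlinarith
  have t2 : t ≤ Real.pi - Real.pi / M := by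
    have : Real.pi - Real.pi / M = Real.pi * (M - 1) / M := by field_simp
    rw [this, ht]; gcongr
  have hp0 : 0 < Real.pi / M := by positivity
  have key : ∀ u : ℝ, Real.pi / M ≤ u → u ≤ Real.pi / 2 → 2 / (M : ℝ) ≤ Real.sin u := by
    intro u hu hu'
    refine le_trans ?_ (Real.mul_le_sin (hp0.le.trans hu) hu')
    calc 2 / (M : ℝ) = 2 / Real.pi * (Real.pi / M) := by field_simp
      _ ≤ _ := by gcongr
  have : 2 / (M : ℝ) ≤ Real.sin t := by
    rcases le_total t (Real.pi / 2) with h5 | h5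
    · exact key t t1 h5
    · rw [← Real.sin_pi_sub]
      exact key _ (by linarith) (by linarith)
  calc 4 / (M : ℝ) = 2 * (2 / M) := by ring
    _ ≤ _ := by gcongr

/-- Choice of the power `T`. -/
lemma exists_T (ε : ℝ) (h0 : 0 < ε) (h1 : ε < 1) :
    ∃ T : ℕ, (T : ℝ) ≤ 3 / ε ∧ (1 - ε) ^ T ≤ 1 / 7 := by
  refine ⟨⌈2 / ε⌉₊, ?_, ?_⟩
  · have := (Nat.ceil_lt_add_one (show 0 ≤ 2 / ε by positivity)).le
    have h2 : 1 ≤ 1 / ε := by rw [le_div_iff₀ h0]; linarith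
    have h3 : 3 / ε = 2 / ε + 1 / ε := by ring
    linarith
  · have h2 : 1 - ε ≤ Real.exp (-ε) := by
      have := Real.add_one_le_exp (-ε); linarith
    have h3 : (1 - ε) ^ ⌈2 / ε⌉₊ ≤ Real.exp (-ε) ^ ⌈2 / ε⌉₊ :=
      pow_le_pow_left₀ (by linarith) h2 _
    refine h3.trans ?_
    rw [← Real.exp_nat_mul]
    have h4 : (⌈2 / ε⌉₊ : ℝ) * -ε ≤ -2 := by
      have := Nat.le_ceil (2 / ε)
      rw [div_le_iff₀ h0] at this
      linarith
    refine (Real.exp_le_exp.2 h4).trans ?_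
    rw [Real.exp_neg, ← one_div]
    have h5 : (7 : ℝ) ≤ Real.exp 2 := by
      have := Real.exp_one_gt_d9
      have h6 : Real.exp 2 = Real.exp 1 * Real.exp 1 := by rw [← Real.exp_add]; norm_num
      nlinarith
    gcongr

/-- The numerical inequality behind the explicit constants. -/
lemma numeric (d : ℕ) (hd : 1 ≤ d) (B : ℝ) (hB : B = 12 * (4 / 3 : ℝ) ^ (d - 1) - 21 / 2) :
    (1 + 2 * B) ^ (2 * d) ≤ 3 ^ d * 4 ^ (d ^ 2) * (3 * B) := by
  by_cases h6 : d < 6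
  · interval_cases d <;> subst hB <;> norm_num
  · push Not at h6
    have hg : (1 : ℝ) ≤ (4 / 3 : ℝ) ^ (d - 1) := one_le_pow₀ (by norm_num)
    have hB1 : 1 ≤ 3 * B := by rw [hB]; linarith
    have hg2 : (4 / 3 : ℝ) ^ d = (4 / 3 : ℝ) ^ (d - 1) * (4 / 3) := by
      rw [← pow_succ]; congr 1; omega
    have hB2 : 1 + 2 * B ≤ 18 * (4 / 3 : ℝ) ^ d := by rw [hB, hg2]; linarith
    have h108 : (108 : ℝ) ≤ (9 / 4 : ℝ) ^ d :=
      le_trans (by norm_num) (pow_le_pow_right₀ (by norm_num) h6)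
    calc (1 + 2 * B) ^ (2 * d) ≤ (18 * (4 / 3 : ℝ) ^ d) ^ (2 * d) :=
          pow_le_pow_left₀ (by linarith) hB2 _
      _ = (324 * (16 / 9 : ℝ) ^ d) ^ d := by
          rw [pow_mul, mul_pow]
          congr 1
          rw [← pow_mul, mul_comm d 2, pow_mul]
          norm_num
      _ = (3 * (108 * (16 / 9 : ℝ) ^ d)) ^ d := by ring
      _ ≤ (3 * ((9 / 4) ^ d * (16 / 9 : ℝ) ^ d)) ^ d := by gcongr
      _ = 3 ^ d * 4 ^ (d ^ 2) := by
          rw [← mul_pow, mul_pow, ← pow_mul, sq]; norm_num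
      _ ≤ _ := le_mul_of_one_le_right (by positivity) hB1
lemma exists_eigvec {d : ℕ} (A : Matrix (Fin d) (Fin d) ℂ) (μ : ℂ) (h : μ ∈ spectrum ℂ A) :
    ∃ w : Fin d → ℂ, w ≠ 0 ∧ A.mulVec w = μ • w := by
  rw [Matrix.mem_spectrum_iff_isRoot_charpoly, Polynomial.IsRoot, Matrix.eval_charpoly,
    ← Matrix.exists_mulVec_eq_zero_iff] at h
  obtain ⟨w, hw, h⟩ := h
  refine ⟨w, hw, ?_⟩
  rw [Matrix.sub_mulVec, sub_eq_zero] at h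
  rw [← h]
  ext i
  simp [Matrix.scalar_apply, Matrix.mulVec_diagonal]

lemma mem_spectrum_of_eigvec {d : ℕ} (A : Matrix (Fin d) (Fin d) ℂ) (μ : ℂ) (w : Fin d → ℂ)
    (hw : w ≠ 0) (h : A.mulVec w = μ • w) : μ ∈ spectrum ℂ A := by
  rw [Matrix.mem_spectrum_iff_isRoot_charpoly, Polynomial.IsRoot, Matrix.eval_charpoly,
    ← Matrix.exists_mulVec_eq_zero_iff]
  refine ⟨w, hw, ?_⟩
  rw [Matrix.sub_mulVec, sub_eq_zero, h]
  ext i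
  simp [Matrix.scalar_apply, Matrix.mulVec_diagonal]

open Polynomial in
lemma resolvent_aux {d : ℕ} (p : Seminorm ℂ (Fin d → ℂ)) (A : Matrix (Fin d) (Fin d) ℂ)
    (hA : ∀ y, p (A.mulVec y) ≤ p y) (ε : ℝ) (h0 : 0 < ε) (h1 : ε < 1) (m : ℕ) :
    ∀ l : Multiset ℂ, l.card = m + 1 → (∀ μ ∈ l, ‖μ‖ ≤ 1 - ε) → ∀ x : Fin d → ℂ,
      (aeval A (l.map fun μ => (X - C μ : ℂ[X])).prod).mulVec x = 0 →
      p x ≤ ((23 / 2 * (4 / 3 : ℝ) ^ m - 21 / 2) / ε) * p (A.mulVec x - x) := by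
  obtain ⟨T, hT, hq⟩ := exists_T ε h0 h1
  have hpow : ∀ k y, p ((A ^ k).mulVec y) ≤ p y := by
    intro k
    induction k with
    | zero => intro y; simp
    | succ k ih =>
      intro y
      rw [pow_succ, ← Matrix.mulVec_mulVec]
      exact (ih _).trans (hA y)
  have htel : ∀ (k : ℕ) (x : Fin d → ℂ), p ((A ^ k).mulVec x - x) ≤ k * p (A.mulVec x - x) := by
    intro k x
    induction k with
    | zero => simp
    | succ k ih =>
      have : (A ^ (k + 1)).mulVec x - x
          = (A ^ k).mulVec (A.mulVec x - x) + ((A ^ k).mulVec x - x) := by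
        rw [Matrix.mulVec_sub, Matrix.mulVec_mulVec, ← pow_succ]; abel
      rw [this]
      refine (map_add_le_add p _ _).trans ?_
      push_cast
      linarith [hpow k (A.mulVec x - x)]
  induction m with
  | zero =>
    intro l hl hμ x hx
    obtain ⟨μ, rfl⟩ := Multiset.card_eq_one.1 hl
    have hμ := hμ μ (by simp)
    have hx' : A.mulVec x = μ • x := by
      simp only [Multiset.map_singleton, Multiset.prod_singleton, map_sub, aeval_X, aeval_C,
        Matrix.sub_mulVec, Algebra.algebraMap_eq_smul_one, Matrix.smul_mulVec,
        Matrix.one_mulVec] at hx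
      exact sub_eq_zero.1 hx
    have e : A.mulVec x - x = (μ - 1) • x := by rw [hx', sub_smul, one_smul]
    have h3 : ε ≤ ‖μ - 1‖ := by
      have := norm_sub_norm_le (1 : ℂ) μ
      rw [norm_one, norm_sub_rev] at this
      linarith
    rw [e, map_smul_eq_mul]
    have : p x = 1 / ε * (ε * p x) := by field_simp
    have hc : (23 / 2 * (4 / 3 : ℝ) ^ 0 - 21 / 2) / ε = 1 / ε := by norm_num
    rw [hc]
    refine this.le.trans ?_
    exact mul_le_mul_of_nonneg_left (mul_le_mul_of_nonneg_right h3 (apply_nonneg p x))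
      (by positivity)
  | succ m ih =>
    intro l hl hμ x hx
    obtain ⟨μ, l', rfl⟩ : ∃ μ l', l = μ ::ₘ l' := by
      obtain ⟨μ, hm⟩ := Multiset.card_pos_iff_exists_mem.1 (show 0 < l.card by omega)
      exact ⟨μ, Multiset.exists_cons_of_mem hm⟩
    have hl' : l'.card = m + 1 := by simpa using hl
    have hμ0 := hμ μ (by simp)
    have hμ' : ∀ μ ∈ l', ‖μ‖ ≤ 1 - ε := fun ν hν => hμ ν (by simp [hν])
    set Q := (l'.map fun μ => (X - C μ : ℂ[X])).prod with hQ
    set z := (A ^ T).mulVec x - (μ ^ T) • x with hz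
    have hzQ : (aeval A Q).mulVec z = 0 := by
      obtain ⟨w, hw⟩ := sub_dvd_pow_sub_pow (X : ℂ[X]) (C μ) T
      have hz2 : z = (aeval A (X ^ T - C μ ^ T)).mulVec x := by
        rw [hz]
        simp [Matrix.sub_mulVec, Algebra.algebraMap_eq_smul_one, _root_.smul_pow, Matrix.smul_mulVec]
      rw [hz2, Matrix.mulVec_mulVec, ← map_mul, hw]
      have : Q * ((X - C μ) * w) = w * ((X - C μ) * Q) := by ring
      rw [this, map_mul, ← Matrix.mulVec_mulVec]
      rw [Multiset.map_cons, Multiset.prod_cons] at hx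
      rw [hx, Matrix.mulVec_zero]
    have hb := ih l' hl' hμ' z hzQ
    set D := p (A.mulVec x - x) with hD
    have hD0 : 0 ≤ D := apply_nonneg p _
    have hqμ : ‖μ ^ T‖ ≤ 1 / 7 := by
      rw [norm_pow]
      exact (pow_le_pow_left₀ (norm_nonneg _) hμ0 _).trans hq
    have hAz : p (A.mulVec z - z) ≤ 8 / 7 * D := by
      have : A.mulVec z - z = (A ^ T).mulVec (A.mulVec x - x) - (μ ^ T) • (A.mulVec x - x) := by
        rw [hz]
        simp only [Matrix.mulVec_sub, Matrix.mulVec_smul, Matrix.mulVec_mulVec, smul_sub,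
          ← pow_succ, ← pow_succ']
        abel
      rw [this]
      refine (map_sub_le_add p _ _).trans ?_
      rw [map_smul_eq_mul]
      have := hpow T (A.mulVec x - x)
      nlinarith
    have hg : (1 : ℝ) ≤ (4 / 3 : ℝ) ^ m := one_le_pow₀ (by norm_num)
    have hzb : p z ≤ ((23 / 2 * (4 / 3 : ℝ) ^ m - 21 / 2) / ε) * (8 / 7 * D) :=
      hb.trans (mul_le_mul_of_nonneg_left hAz (div_nonneg (by linarith) h0.le))
    have hx1 : (1 - μ ^ T) • x = z - ((A ^ T).mulVec x - x) := by
      rw [hz, sub_smul, one_smul]; abel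
    have hx2 : ‖1 - μ ^ T‖ * p x ≤ p z + T * D := by
      rw [← map_smul_eq_mul, hx1]
      refine (map_sub_le_add p _ _).trans ?_
      linarith [htel T x]
    have hx3 : 6 / 7 ≤ ‖1 - μ ^ T‖ := by
      have := norm_sub_norm_le (1 : ℂ) (μ ^ T)
      rw [norm_one] at this
      linarith
    have hx4 : 6 / 7 * p x ≤ p z + T * D :=
      (mul_le_mul_of_nonneg_right hx3 (apply_nonneg p x)).trans hx2
    have hTD : T * D ≤ 3 / ε * D := mul_le_mul_of_nonneg_right hT hD0
    have : p x ≤ 7 / 6 * (((23 / 2 * (4 / 3 : ℝ) ^ m - 21 / 2) / ε) * (8 / 7 * D) + 3 / ε * D) := by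
      linarith
    refine this.trans (le_of_eq ?_)
    rw [pow_succ]
    field_simp
    ring

lemma resolvent_bound {d : ℕ} (hd : 1 ≤ d) (p : Seminorm ℂ (Fin d → ℂ))
    (A : Matrix (Fin d) (Fin d) ℂ)
    (hA : ∀ y, p (A.mulVec y) ≤ p y) (ε : ℝ) (h0 : 0 < ε) (h1 : ε < 1)
    (hsp : ∀ μ ∈ spectrum ℂ A, ‖μ‖ ≤ 1 - ε) (x : Fin d → ℂ) :
    p x ≤ ((23 / 2 * (4 / 3 : ℝ) ^ (d - 1) - 21 / 2) / ε) * p (A.mulVec x - x) := by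
  have hs := IsAlgClosed.splits A.charpoly
  refine resolvent_aux p A hA ε h0 h1 (d - 1) A.charpoly.roots ?_ ?_ x ?_
  · rw [← hs.natDegree_eq_card_roots, Matrix.charpoly_natDegree_eq_dim, Fintype.card_fin]; omega
  · intro μ hμ
    exact hsp μ (Matrix.mem_spectrum_iff_isRoot_charpoly.2 (Polynomial.isRoot_of_mem_roots hμ))
  · rw [← hs.eq_prod_roots_of_monic A.charpoly_monic, Matrix.aeval_self_charpoly,
      Matrix.zero_mulVec]
/-- All elements of `S` are bounded by `C` for the sup norm. -/
def OpB {d : ℕ} (S : Set (Matrix (Fin d) (Fin d) ℂ)) (C : ℝ) : Prop :=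
  ∀ s ∈ S, ∀ x : Fin d → ℂ, ‖s.mulVec x‖ ≤ C * ‖x‖

lemma opB_of_matBdd {d : ℕ} {S : Set (Matrix (Fin d) (Fin d) ℂ)} (h : MatBdd S) :
    ∃ C : ℝ, 1 ≤ C ∧ OpB S C := by
  obtain ⟨C, hC⟩ := h
  refine ⟨max 1 (d * C), le_max_left _ _, fun s hs x => ?_⟩
  rw [pi_norm_le_iff_of_nonneg (by positivity)]
  intro i
  calc ‖s.mulVec x i‖ = ‖∑ j, s i j * x j‖ := rfl
    _ ≤ ∑ j, ‖s i j * x j‖ := norm_sum_le _ _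
    _ ≤ ∑ _j : Fin d, C * ‖x‖ := by
        refine Finset.sum_le_sum fun j _ => ?_
        rw [norm_mul]
        exact mul_le_mul (hC s hs i j) (norm_le_pi_norm x j) (norm_nonneg _)
          ((norm_nonneg _).trans (hC s hs i j))
    _ = (d * C) * ‖x‖ := by simp [mul_assoc]
    _ ≤ _ := by gcongr; exact le_max_right _ _

lemma opB_mul {d : ℕ} {S R : Set (Matrix (Fin d) (Fin d) ℂ)} {a b : ℝ} (ha : 0 ≤ a)
    (hS : OpB S a) (hR : OpB R b) : OpB (S * R) (a * b) := by
  intro s hs x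
  obtain ⟨u, hu, w, hw, rfl⟩ := Set.mem_mul.1 hs
  rw [← Matrix.mulVec_mulVec]
  refine (hS u hu _).trans ?_
  rw [mul_assoc]
  exact mul_le_mul_of_nonneg_left (hR w hw x) ha

lemma opB_pow {d : ℕ} {S : Set (Matrix (Fin d) (Fin d) ℂ)} {a : ℝ} (ha : 0 ≤ a)
    (hS : OpB S a) (k : ℕ) : OpB (S ^ k) (a ^ k) := by
  induction k with
  | zero =>
    intro s hs x
    rw [pow_zero, Set.mem_one] at hs
    simp [hs]
  | succ k ih =>
    rw [pow_succ, pow_succ]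
    exact opB_mul (pow_nonneg ha _) ih hS

lemma opNorm_le {d : ℕ} {A : Matrix (Fin d) (Fin d) ℂ} {C : ℝ} (hC : 0 ≤ C)
    (h : ∀ x : Fin d → ℂ, ‖A.mulVec x‖ ≤ C * ‖x‖) : opNorm stdNorm A ≤ C := by
  refine Real.sSup_le ?_ hC
  rintro c ⟨x, hx, rfl⟩
  exact (h x).trans (mul_le_of_le_one_right hC hx)

lemma le_opNorm {d : ℕ} {A : Matrix (Fin d) (Fin d) ℂ} {C : ℝ} (hC : 0 ≤ C)
    (h : ∀ x : Fin d → ℂ, ‖A.mulVec x‖ ≤ C * ‖x‖) (x : Fin d → ℂ) :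
    ‖A.mulVec x‖ ≤ opNorm stdNorm A * ‖x‖ := by
  by_cases hx : x = 0
  · simp [hx]
  have hx' : 0 < ‖x‖ := norm_pos_iff.2 hx
  have hb : BddAbove {c : ℝ | ∃ x : Fin d → ℂ, stdNorm x ≤ 1 ∧ c = stdNorm (A.mulVec x)} := by
    refine ⟨C, ?_⟩
    rintro c ⟨x, hx, rfl⟩
    exact (h x).trans (mul_le_of_le_one_right hC hx)
  have h1 : ‖A.mulVec (((‖x‖⁻¹ : ℝ) : ℂ) • x)‖ ≤ opNorm stdNorm A := by
    refine le_csSup hb ⟨((‖x‖⁻¹ : ℝ) : ℂ) • x, ?_, rfl⟩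
    rw [stdNorm, norm_smul, Complex.norm_real, norm_inv, norm_norm, inv_mul_cancel₀ hx'.ne']
  rw [Matrix.mulVec_smul, norm_smul, Complex.norm_real, norm_inv, norm_norm, inv_mul_le_iff₀ hx']
    at h1
  linarith

lemma setOpNorm_le {d : ℕ} {S : Set (Matrix (Fin d) (Fin d) ℂ)} {C : ℝ} (hC : 0 ≤ C)
    (h : OpB S C) : setOpNorm stdNorm S ≤ C := by
  refine Real.sSup_le ?_ hC
  rintro _ ⟨s, hs, rfl⟩
  exact opNorm_le hC (h s hs)

lemma opB_setOpNorm {d : ℕ} {S : Set (Matrix (Fin d) (Fin d) ℂ)} {C : ℝ} (hC : 0 ≤ C)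
    (h : OpB S C) : OpB S (setOpNorm stdNorm S) := by
  intro s hs x
  refine (le_opNorm hC (h s hs) x).trans ?_
  refine mul_le_mul_of_nonneg_right ?_ (norm_nonneg _)
  refine le_csSup ⟨C, ?_⟩ ⟨s, hs, rfl⟩
  rintro _ ⟨s, hs, rfl⟩
  exact opNorm_le hC (h s hs)

lemma setOpNorm_nonneg {d : ℕ} (S : Set (Matrix (Fin d) (Fin d) ℂ)) :
    0 ≤ setOpNorm stdNorm S := by
  refine Real.sSup_nonneg ?_
  rintro _ ⟨s, hs, rfl⟩
  refine Real.sSup_nonneg ?_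
  rintro _ ⟨x, hx, rfl⟩
  exact norm_nonneg _

lemma one_le_setOpNorm {d : ℕ} {S : Set (Matrix (Fin d) (Fin d) ℂ)} (hρ : jsr S = 1) (m : ℕ) :
    1 ≤ setOpNorm stdNorm (S ^ (m + 1)) := by
  have h1 : jsr S ≤ setOpNorm stdNorm (S ^ (m + 1)) ^ (1 / (m + 1 : ℝ)) := by
    refine ciInf_le (f := fun n : ℕ => setOpNorm stdNorm (S ^ (n + 1)) ^ (1 / (n + 1 : ℝ)))
      ⟨0, ?_⟩ m
    rintro _ ⟨n, rfl⟩
    exact Real.rpow_nonneg (setOpNorm_nonneg _) _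
  rw [hρ] at h1
  by_contra hlt
  push Not at hlt
  exact absurd h1 (not_le.2 (Real.rpow_lt_one (setOpNorm_nonneg _) hlt (by positivity)))

/-- Uniform bound for the weighted products. -/
lemma exists_unif {d : ℕ} {S : Set (Matrix (Fin d) (Fin d) ℂ)} (hS : MatBdd S)
    (hρ : jsr S = 1) (θ : ℝ) (h0 : 0 < θ) (h1 : θ < 1) :
    ∃ C : ℝ, 0 ≤ C ∧ ∀ k, OpB (S ^ k) (C * (θ⁻¹) ^ k) := by
  obtain ⟨a, ha1, ha⟩ := opB_of_matBdd hS
  have ha0 : 0 ≤ a := by linarith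
  have hθ : 1 < θ⁻¹ := (one_lt_inv₀ h0).2 h1
  have hlt : jsr S < θ⁻¹ := by rw [hρ]; exact hθ
  obtain ⟨m, hm⟩ := exists_lt_of_ciInf_lt hlt
  have hm2 : setOpNorm stdNorm (S ^ (m + 1)) ≤ θ⁻¹ ^ (m + 1) := by
    have h2 := Real.rpow_le_rpow (Real.rpow_nonneg (setOpNorm_nonneg _) _) hm.le
      (show (0 : ℝ) ≤ ((m + 1 : ℕ) : ℝ) by positivity)
    rw [← Real.rpow_mul (setOpNorm_nonneg _), Real.rpow_natCast] at h2
    have h3 : (1 / (m + 1 : ℝ)) * ((m + 1 : ℕ) : ℝ) = 1 := by push_cast; field_simp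
    rwa [h3, Real.rpow_one] at h2
  have hB : OpB (S ^ (m + 1)) (θ⁻¹ ^ (m + 1)) := by
    intro s hs x
    exact (opB_setOpNorm (pow_nonneg ha0 _) (opB_pow ha0 ha (m + 1)) s hs x).trans (by gcongr)
  refine ⟨a ^ (m + 1), by positivity, fun k => ?_⟩
  have hk : S ^ k = (S ^ (m + 1)) ^ (k / (m + 1)) * S ^ (k % (m + 1)) := by
    rw [← pow_mul, ← pow_add, Nat.div_add_mod]
  rw [hk]
  have := opB_mul (by positivity) (opB_pow (by positivity) hB (k / (m + 1)))
    (opB_pow ha0 ha (k % (m + 1)))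
  intro s hs x
  refine (this s hs x).trans ?_
  have e1 : (θ⁻¹ ^ (m + 1)) ^ (k / (m + 1)) ≤ θ⁻¹ ^ k := by
    rw [← pow_mul]
    exact pow_le_pow_right₀ hθ.le (Nat.mul_div_le k (m + 1))
  have e2 : a ^ (k % (m + 1)) ≤ a ^ (m + 1) :=
    pow_le_pow_right₀ ha1 (Nat.mod_lt _ (Nat.succ_pos _)).le
  rw [mul_comm (a ^ (m + 1))]
  gcongr

/-- A Rota–Strang type norm. -/
lemma exists_norm {d : ℕ} {S : Set (Matrix (Fin d) (Fin d) ℂ)} (hS : MatBdd S)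
    (hρ : jsr S = 1) (θ : ℝ) (h0 : 0 < θ) (h1 : θ < 1) :
    ∃ (p : Seminorm ℂ (Fin d → ℂ)) (C : ℝ), 0 ≤ C ∧ (∀ x, ‖x‖ ≤ p x) ∧ (∀ x, p x ≤ C * ‖x‖) ∧
      ∀ k, ∀ s ∈ S ^ k, ∀ x, θ ^ k * p (s.mulVec x) ≤ p x := by
  obtain ⟨C, hC, hB⟩ := exists_unif hS hρ θ h0 h1
  let I := {a : ℕ × Matrix (Fin d) (Fin d) ℂ // a.2 ∈ S ^ a.1}
  have : Nonempty I := ⟨⟨(0, 1), by simp⟩⟩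
  let F : I → (Fin d → ℂ) → ℝ := fun a x => θ ^ a.1.1 * ‖a.1.2.mulVec x‖
  have hF : ∀ a x, F a x ≤ C * ‖x‖ := by
    rintro ⟨⟨k, s⟩, hs⟩ x
    calc θ ^ k * ‖s.mulVec x‖ ≤ θ ^ k * (C * θ⁻¹ ^ k * ‖x‖) := by gcongr; exact hB k s hs x
      _ = (θ * θ⁻¹) ^ k * (C * ‖x‖) := by rw [mul_pow]; ring
      _ = C * ‖x‖ := by rw [mul_inv_cancel₀ h0.ne', one_pow, one_mul]
  have hbdd : ∀ x, BddAbove (Set.range fun a => F a x) := by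
    intro x
    refine ⟨C * ‖x‖, ?_⟩
    rintro _ ⟨a, rfl⟩
    exact hF a x
  let p : Seminorm ℂ (Fin d → ℂ) := Seminorm.of (fun x => ⨆ a, F a x)
    (by
      intro x y
      refine ciSup_le fun a => ?_
      refine le_trans ?_ (add_le_add (le_ciSup (hbdd x) a) (le_ciSup (hbdd y) a))
      simp only [F]
      rw [Matrix.mulVec_add, ← mul_add]
      gcongr
      exact norm_add_le _ _)
    (by
      intro c x
      have : ∀ a, F a (c • x) = ‖c‖ * F a x := by
        intro a
        simp only [F]
        rw [Matrix.mulVec_smul, norm_smul]; ring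
      simp only [this]
      rw [Real.mul_iSup_of_nonneg (norm_nonneg _)])
  have hp : ∀ x, p x = ⨆ a, F a x := fun x => rfl
  refine ⟨p, C, hC, fun x => ?_, fun x => ?_, fun k s hs x => ?_⟩
  · rw [hp]
    refine le_trans (le_of_eq ?_) (le_ciSup (hbdd x) ⟨(0, 1), by simp⟩)
    simp [F]
  · rw [hp]
    exact ciSup_le fun a => hF a x
  · rw [hp, hp, Real.mul_iSup_of_nonneg (by positivity)]
    refine ciSup_le fun a => ?_
    obtain ⟨⟨j, u⟩, hu⟩ := a
    have hmem : u * s ∈ S ^ (j + k) := by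
      rw [pow_add]; exact Set.mul_mem_mul hu hs
    refine le_trans (le_of_eq ?_) (le_ciSup (hbdd x) ⟨(j + k, u * s), hmem⟩)
    simp only [F]
    rw [Matrix.mulVec_mulVec, pow_add]
    ring

/-- A long product which almost does not contract. -/
lemma exists_long {d : ℕ} {S : Set (Matrix (Fin d) (Fin d) ℂ)}
    (hρ : jsr S = 1) (θ : ℝ) (h0 : 0 < θ) (h1 : θ < 1)
    (p : Seminorm ℂ (Fin d → ℂ)) (C : ℝ) (hC : 0 ≤ C) (hlow : ∀ x, ‖x‖ ≤ p x)
    (hup : ∀ x, p x ≤ C * ‖x‖) (n : ℕ) (hn : 1 ≤ n) :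
    ∃ s ∈ S ^ n, ∃ x, θ ^ n * p x < p (s.mulVec x) := by
  by_contra! hcon
  have hit : ∀ m, ∀ s ∈ (S ^ n) ^ m, ∀ x, p (s.mulVec x) ≤ (θ ^ n) ^ m * p x := by
    intro m
    induction m with
    | zero =>
      intro s hs x
      rw [pow_zero, Set.mem_one] at hs
      simp [hs]
    | succ m ih =>
      intro s hs x
      rw [pow_succ] at hs
      obtain ⟨u, hu, w, hw, rfl⟩ := Set.mem_mul.1 hs
      rw [← Matrix.mulVec_mulVec]
      refine (ih u hu _).trans ?_
      rw [pow_succ, mul_assoc]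
      exact mul_le_mul_of_nonneg_left (hcon w hw x) (by positivity)
  have hq0 : 0 < θ ^ n := by positivity
  have hq1 : θ ^ n < 1 := pow_lt_one₀ h0.le h1 (by omega)
  obtain ⟨m, hm⟩ := exists_pow_lt_of_lt_one (show 0 < 1 / (C + 1) by positivity) hq1
  have hm' : (θ ^ n) ^ (m + 1) < 1 / (C + 1) :=
    lt_of_le_of_lt (pow_le_pow_of_le_one hq0.le hq1.le (Nat.le_succ m)) hm
  have hb : OpB (S ^ (n * (m + 1))) ((θ ^ n) ^ (m + 1) * C) := by
    intro s hs x
    rw [pow_mul] at hs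
    calc ‖s.mulVec x‖ ≤ p (s.mulVec x) := hlow _
      _ ≤ (θ ^ n) ^ (m + 1) * p x := hit _ s hs x
      _ ≤ (θ ^ n) ^ (m + 1) * (C * ‖x‖) := by gcongr; exact hup x
      _ = _ := by ring
  have h2 := setOpNorm_le (by positivity) hb
  obtain ⟨j, hj⟩ : ∃ j, n * (m + 1) = j + 1 :=
    ⟨n * (m + 1) - 1, by have : 0 < n * (m + 1) := by positivity
                         omega⟩
  rw [hj] at h2
  have h3 := (one_le_setOpNorm hρ j).trans h2
  have h4 : (θ ^ n) ^ (m + 1) * C ≤ 1 / (C + 1) * C := by gcongr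
  have h5 : 1 / (C + 1) * C < 1 := by
    rw [one_div, inv_mul_lt_iff₀ (by positivity)]; linarith
  linarith

/-- The trajectory attached to a product. -/
lemma exists_traj {d : ℕ} {S : Set (Matrix (Fin d) (Fin d) ℂ)} (n : ℕ)
    (s : Matrix (Fin d) (Fin d) ℂ) (hs : s ∈ S ^ n) (x : Fin d → ℂ) :
    ∃ y : ℕ → Fin d → ℂ, y 0 = x ∧ y n = s.mulVec x ∧
      ∀ i j, i ≤ j → j ≤ n → ∃ A ∈ S ^ (j - i), y j = A.mulVec (y i) := by
  induction n generalizing s with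
  | zero =>
    rw [pow_zero, Set.mem_one] at hs
    refine ⟨fun _ => x, rfl, by simp [hs], fun i j hij hj => ⟨1, ?_, by simp⟩⟩
    have : j - i = 0 := by omega
    simp [this]
  | succ n ih =>
    rw [pow_succ'] at hs
    obtain ⟨a, ha, b, hb, rfl⟩ := Set.mem_mul.1 hs
    obtain ⟨y, y0, yn, hy⟩ := ih b hb
    refine ⟨Function.update y (n + 1) (a.mulVec (y n)), ?_, ?_, ?_⟩
    · rw [Function.update_of_ne (by omega), y0]
    · rw [Function.update_self, yn, Matrix.mulVec_mulVec]
    · intro i j hij hj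
      rcases Nat.lt_or_ge n j with h | h
      · have hj' : j = n + 1 := by omega
        subst hj'
        rw [Function.update_self]
        rcases Nat.lt_or_ge n i with h' | h'
        · have : i = n + 1 := by omega
          subst this
          exact ⟨1, by simp, by simp⟩
        · rw [Function.update_of_ne (by omega)]
          obtain ⟨A, hA, hA'⟩ := hy i n h' le_rfl
          refine ⟨a * A, ?_, by rw [hA', Matrix.mulVec_mulVec]⟩
          have : n + 1 - i = (n - i) + 1 := by omega
          rw [this, pow_succ']
          exact Set.mul_mem_mul ha hA
      · rw [Function.update_of_ne (by omega), Function.update_of_ne (by omega)]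
        exact hy i j hij h

lemma norm_le_lamSet {d : ℕ} {S : Set (Matrix (Fin d) (Fin d) ℂ)} {C : ℝ} (hC : 0 ≤ C)
    (h : OpB S C) (A : Matrix (Fin d) (Fin d) ℂ) (hA : A ∈ S) (μ : ℂ) (hμ : μ ∈ spectrum ℂ A) :
    ‖μ‖ ≤ lamSet S := by
  have h1 : ‖μ‖ ≤ specRad A :=
    le_csSup ((Matrix.finite_spectrum A).image _).bddAbove ⟨μ, hμ, rfl⟩
  refine h1.trans (le_csSup ⟨C, ?_⟩ ⟨A, hA, rfl⟩)
  rintro _ ⟨s, hs, rfl⟩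
  refine Real.sSup_le ?_ hC
  rintro _ ⟨ν, hν, rfl⟩
  obtain ⟨w, hw, hw'⟩ := exists_eigvec s ν hν
  have h2 := h s hs w
  rw [hw', norm_smul] at h2
  exact le_of_mul_le_mul_right h2 (norm_pos_iff.2 hw)

lemma lamSet_nonneg {d : ℕ} (S : Set (Matrix (Fin d) (Fin d) ℂ)) : 0 ≤ lamSet S := by
  refine Real.sSup_nonneg ?_
  rintro _ ⟨s, hs, rfl⟩
  refine Real.sSup_nonneg ?_
  rintro _ ⟨x, hx, rfl⟩
  exact norm_nonneg _
lemma exists_theta (n : ℕ) (c : ℝ) (hc : c < 1) : ∃ θ : ℝ, 0 < θ ∧ θ < 1 ∧ c < θ ^ (2 * n) := by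
  have hcont : Tendsto (fun t : ℝ => t ^ (2 * n)) (nhdsWithin 1 (Set.Iio 1)) (nhds 1) := by
    have : Continuous fun t : ℝ => t ^ (2 * n) := by fun_prop
    have h := this.tendsto 1
    rw [one_pow] at h
    exact h.mono_left nhdsWithin_le_nhds
  have h1 := hcont.eventually (lt_mem_nhds hc)
  have h2 : ∀ᶠ t : ℝ in nhdsWithin 1 (Set.Iio 1), t ∈ Set.Ioo (0 : ℝ) 1 :=
    Ioo_mem_nhdsLT one_pos
  obtain ⟨θ, h3, h4⟩ := (h1.and h2).exists
  exact ⟨θ, h4.1, h4.2, h3⟩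

lemma final_count (d : ℕ) (hd : 1 ≤ d) (B : ℝ) (hB : B = 12 * (4 / 3 : ℝ) ^ (d - 1) - 21 / 2)
    (hB1 : 3 / 2 ≤ B) (ε : ℝ) (h0 : 0 < ε) (h1 : ε < 1) (n M : ℕ)
    (hn : (ε ^ (-(d ^ 2 : ℤ))) * (3 ^ d * 4 ^ (d ^ 2)) ≤ (n : ℝ)) (hM : 3 * B / ε ≤ M) :
    (1 + ε / B / 2) ^ (2 * d) < ((n + 1 : ℕ) * M : ℝ) * (ε / B / 2) ^ (2 * d) := by
  have hBpos : 0 < B := by linarith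
  have hMpos : (0 : ℝ) < M := lt_of_lt_of_le (by positivity) hM
  have hn2 : (3 : ℝ) ^ d * 4 ^ (d ^ 2) ≤ n * ε ^ (d ^ 2) := by
    have e : (ε ^ (-(d ^ 2 : ℤ))) = (ε ^ (d ^ 2))⁻¹ := by
      rw [zpow_neg]; norm_cast
    rw [e, inv_mul_le_iff₀ (by positivity)] at hn
    linarith
  have hM2 : 3 * B ≤ M * ε := by rwa [div_le_iff₀ h0] at hM
  have hexp : 2 * d ≤ d ^ 2 + 1 := by
    zify; nlinarith [sq_nonneg ((d : ℤ) - 1)]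
  have key : (ε + 2 * B) ^ (2 * d) ≤ n * M * ε ^ (2 * d) := by
    calc (ε + 2 * B) ^ (2 * d) ≤ (1 + 2 * B) ^ (2 * d) := by gcongr
      _ ≤ 3 ^ d * 4 ^ (d ^ 2) * (3 * B) := numeric d hd B hB
      _ ≤ (n * ε ^ (d ^ 2)) * (M * ε) := by gcongr
      _ = n * M * ε ^ (d ^ 2 + 1) := by ring
      _ ≤ _ := by
        gcongr ?_ * ?_
        exact pow_le_pow_of_le_one h0.le h1.le hexp
  have e1 : (1 + ε / B / 2) ^ (2 * d) = (ε + 2 * B) ^ (2 * d) / (2 * B) ^ (2 * d) := by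
    rw [← div_pow]; congr 1; field_simp; ring
  have e2 : (ε / B / 2) ^ (2 * d) = ε ^ (2 * d) / (2 * B) ^ (2 * d) := by
    rw [← div_pow]; congr 1; field_simp
  rw [e1, e2, ← mul_div_assoc]
  refine div_lt_div_of_pos_right ?_ (by positivity)
  refine key.trans_lt ?_
  have : 0 < ε ^ (2 * d) := by positivity
  push_cast
  nlinarith [mul_pos hMpos this]

/-- if `S` is bounded with `ρ(S) = 1`, `ε > 0` and
`n ≥ ε^{−d²}·3^d·4^{d²}`, then `max_{k ≤ n} Λ(S^k) ≥ 1 − ε`. -/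
theorem stmt_12 {d : ℕ} (S : Set (Matrix (Fin d) (Fin d) ℂ)) (hS : MatBdd S)
    (hρ : jsr S = 1) (ε : ℝ) (hε : 0 < ε) (n : ℕ)
    (hn : (ε ^ (-(d ^ 2 : ℤ))) * (3 ^ d * 4 ^ (d ^ 2)) ≤ (n : ℝ)) :
    ∃ k : ℕ, 1 ≤ k ∧ k ≤ n ∧ 1 - ε ≤ lamSet (S ^ k) := by
  have hn1 : 1 ≤ n := by
    have h : (0 : ℝ) < n := lt_of_lt_of_le (by positivity) hn
    exact_mod_cast h
  rcases le_or_gt 1 ε with h1 | h1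
  · exact ⟨1, le_rfl, hn1, le_trans (by linarith) (lamSet_nonneg _)⟩
  by_contra! hcon
  have hd : 1 ≤ d := by
    by_contra hd
    have hd0 : d = 0 := by omega
    subst hd0
    have h2 : OpB (S ^ (0 + 1)) 0 := by
      intro s hs x
      simp [Subsingleton.elim (s.mulVec x) 0]
    have h3 := setOpNorm_le le_rfl h2
    linarith [one_le_setOpNorm hρ 0]
  have hg : (1 : ℝ) ≤ (4 / 3 : ℝ) ^ (d - 1) := one_le_pow₀ (by norm_num)
  obtain ⟨B, hB⟩ : ∃ B : ℝ, B = 12 * (4 / 3 : ℝ) ^ (d - 1) - 21 / 2 := ⟨_, rfl⟩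
  obtain ⟨K, hK⟩ : ∃ K : ℝ, K = 23 / 2 * (4 / 3 : ℝ) ^ (d - 1) - 21 / 2 := ⟨_, rfl⟩
  have hB1 : 3 / 2 ≤ B := by linarith
  have hB0 : 0 < B := by linarith
  have hK0 : 0 < K := by linarith
  have hKB : K < B := by linarith
  obtain ⟨δ, hδ⟩ : ∃ δ : ℝ, δ = ε / B := ⟨_, rfl⟩
  have hδ0 : 0 < δ := by rw [hδ]; positivity
  obtain ⟨M, hM⟩ : ∃ M : ℕ, M = ⌈3 * B / ε⌉₊ := ⟨_, rfl⟩
  have hM1 : 3 * B / ε ≤ M := by rw [hM]; exact Nat.le_ceil _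
  have hMpos : (0 : ℝ) < M := lt_of_lt_of_le (by positivity) hM1
  have hM2 : M * δ / 4 < 1 := by
    have h2 : (M : ℝ) < 3 * B / ε + 1 := by rw [hM]; exact Nat.ceil_lt_add_one (by positivity)
    have h3 : M * δ < (3 * B / ε + 1) * δ := by gcongr
    have h4 : (3 * B / ε + 1) * δ = 3 + ε / B := by rw [hδ]; field_simp
    have h5 : ε / B < 1 := by rw [div_lt_one hB0]; linarith
    linarith
  obtain ⟨θ, θ0, θ1, hθ⟩ := exists_theta n (max (K / B) (M * δ / 4))
    (max_lt (by rwa [div_lt_one hB0]) hM2)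
  have hθ1 := (le_max_left _ _).trans_lt hθ
  have hθ2 := (le_max_right _ _).trans_lt hθ
  obtain ⟨p, C, hC, hlow, hup, hp⟩ := exists_norm hS hρ θ θ0 θ1
  obtain ⟨s, hs, x, hx⟩ := exists_long hρ θ θ0 θ1 p C hC hlow hup n hn1
  have hpx : 0 < p x := by
    have h2 := hp n s hs x
    have h3 : 0 < p (s.mulVec x) :=
      lt_of_le_of_lt (mul_nonneg (by positivity) (apply_nonneg p x)) hx
    exact lt_of_lt_of_le (by positivity) h2
  obtain ⟨y, y0, yn, hy⟩ := exists_traj n s hs x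
  set X : ℕ → Fin d → ℂ := fun i => ((θ ^ i / p x : ℝ) : ℂ) • y i with hX
  have hpX : ∀ i, p (X i) = θ ^ i * p (y i) / p x := by
    intro i
    rw [hX]
    simp only
    rw [map_smul_eq_mul, Complex.norm_real, Real.norm_of_nonneg (by positivity)]
    ring
  have hXle : ∀ i ≤ n, p (X i) ≤ 1 := by
    intro i hi
    obtain ⟨A, hA, hA'⟩ := hy 0 i (Nat.zero_le _) hi
    rw [hpX, div_le_one hpx, hA', y0]
    exact hp i A (by simpa using hA) x
  have hXge : ∀ i ≤ n, θ ^ (2 * n) < p (X i) := by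
    intro i hi
    obtain ⟨A, hA, hA'⟩ := hy i n hi le_rfl
    have h2 := hp _ A hA (y i)
    rw [← hA', yn] at h2
    rw [hpX, lt_div_iff₀ hpx]
    calc θ ^ (2 * n) * p x = θ ^ n * (θ ^ n * p x) := by ring
      _ < θ ^ n * p (s.mulVec x) := by gcongr
      _ = θ ^ i * (θ ^ (n - i) * p (s.mulVec x)) := by
          rw [← mul_assoc, ← pow_add]; congr 2; omega
      _ ≤ θ ^ i * p (y i) := by gcongr
  obtain ⟨a, ha1, ha⟩ := opB_of_matBdd hS
  have ha0 : 0 ≤ a := by linarith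
  have hclose : ∀ i j, i < j → j ≤ n → ∀ c : ℂ, ‖c‖ = 1 → δ ≤ p (X j - c • X i) := by
    intro i j hij hj c hc
    by_contra! hlt
    have hc0 : c ≠ 0 := by intro h; simp [h] at hc
    obtain ⟨A, hA, hA'⟩ := hy i j hij.le hj
    set k := j - i with hk
    set b : ℂ := c⁻¹ * ((θ ^ k : ℝ) : ℂ) with hb
    have hbn : ‖b‖ = θ ^ k := by
      rw [hb, norm_mul, norm_inv, hc, Complex.norm_real, Real.norm_of_nonneg (by positivity)]
      simp
    have hθk : 0 < θ ^ k := by positivity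
    have hb0 : b ≠ 0 := by rw [← norm_pos_iff, hbn]; exact hθk
    have hcontr : ∀ y, p ((b • A).mulVec y) ≤ p y := by
      intro y
      rw [Matrix.smul_mulVec, map_smul_eq_mul, hbn]
      exact hp k A hA y
    have hsp : ∀ μ ∈ spectrum ℂ (b • A), ‖μ‖ ≤ 1 - ε := by
      intro μ hμ
      obtain ⟨w, hw, hw'⟩ := exists_eigvec _ μ hμ
      have h2 : A.mulVec w = (b⁻¹ * μ) • w := by
        rw [Matrix.smul_mulVec] at hw'
        rw [mul_smul, ← hw', smul_smul, inv_mul_cancel₀ hb0, one_smul]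
      have h3 := norm_le_lamSet (pow_nonneg ha0 k) (opB_pow ha0 ha k) A hA _
        (mem_spectrum_of_eigvec A _ w hw h2)
      have h4 := hcon k (by omega) (by omega)
      rw [norm_mul, norm_inv, hbn, inv_mul_le_iff₀ hθk] at h3
      have h5 : θ ^ k * lamSet (S ^ k) ≤ 1 * lamSet (S ^ k) :=
        mul_le_mul_of_nonneg_right (pow_le_one₀ θ0.le θ1.le) (lamSet_nonneg _)
      linarith
    have hAX : (b • A).mulVec (X i) = c⁻¹ • X j := by
      rw [hX]
      simp only
      rw [Matrix.smul_mulVec, Matrix.mulVec_smul, ← hA', smul_smul, smul_smul, hb]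
      congr 1
      have : θ ^ j = θ ^ k * θ ^ i := by rw [← pow_add]; congr 1; omega
      rw [this]; push_cast; ring
    have hdiff : p ((b • A).mulVec (X i) - X i) = p (X j - c • X i) := by
      have : c⁻¹ • X j - X i = c⁻¹ • (X j - c • X i) := by
        rw [smul_sub, smul_smul c⁻¹ c, inv_mul_cancel₀ hc0, one_smul]
      rw [hAX, this, map_smul_eq_mul, norm_inv, hc]
      simp
    have hr := resolvent_bound hd p (b • A) hcontr ε hε h1 hsp (X i)
    rw [hdiff, ← hK] at hr
    have h6 : K / ε * p (X j - c • X i) ≤ K / ε * δ := by gcongr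
    have h7 : K / ε * δ = K / B := by rw [hδ]; field_simp
    linarith [hXge i (by omega)]
  set ζ : Fin M → ℂ := fun m => Complex.exp (Complex.I * ((2 * Real.pi * m / M : ℝ) : ℂ)) with hζ
  have hζ1 : ∀ m, ‖ζ m‖ = 1 := by
    intro m; rw [hζ]; simp only; rw [mul_comm]; exact Complex.norm_exp_ofReal_mul_I _
  have hζ0 : ∀ m, ζ m ≠ 0 := fun m => Complex.exp_ne_zero _
  have hcl2 : ∀ i j, i < j → j ≤ n → ∀ a b, δ ≤ p (ζ a • X j - ζ b • X i) := by
    intro i j hij hj a b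
    have h2 := hclose i j hij hj ((ζ a)⁻¹ * ζ b) (by rw [norm_mul, norm_inv, hζ1, hζ1]; simp)
    have h3 : ζ a • X j - ζ b • X i = ζ a • (X j - ((ζ a)⁻¹ * ζ b) • X i) := by
      rw [smul_sub, smul_smul (ζ a) ((ζ a)⁻¹ * ζ b), ← mul_assoc, mul_inv_cancel₀ (hζ0 a), one_mul]
    rw [h3, map_smul_eq_mul, hζ1, one_mul]
    exact h2
  have hpack := packing p C hlow hup
    (fun q : Fin (n + 1) × Fin M => ζ q.2 • X q.1) (by
      rintro ⟨i, m⟩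
      simp only
      rw [map_smul_eq_mul, hζ1, one_mul]
      exact hXle i (by omega)) δ hδ0 (by
      rintro ⟨i, m⟩ ⟨j, m'⟩ hne
      simp only
      rcases lt_trichotomy i j with h | h | h
      · have := hcl2 i j h (by omega) m' m
        rwa [map_sub_rev]
      · subst h
        have hmm : m ≠ m' := fun h => hne (by rw [h])
        rw [← sub_smul, map_smul_eq_mul]
        have h2 := roots_sep M m m' hmm
        have h3 := hXge i (by omega)
        calc δ = 4 / M * (M * δ / 4) := by field_simp
          _ ≤ 4 / M * p (X i) := by gcongr; linarith
          _ ≤ _ := mul_le_mul_of_nonneg_right h2 (apply_nonneg p _)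
      · exact hcl2 j i h (by omega) m m')
  have hfin := final_count d hd B hB hB1 ε hε h1 n M hn hM1
  rw [Fintype.card_prod, Fintype.card_fin, Fintype.card_fin, hδ] at hpack
  push_cast at hpack hfin
  linarith
end
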